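/- arXiv:1903.01055 — 9 statements merged into one kernel-verified Lean document; each statement's English description precedes it below -/
import Mathlib

section
/- Suppose that for every t ≥ 0 one has x^{(t)}_M = x*_M and λ^{(t)}_N = λ*_N, and that for every t ≥ 0, every k ∈ {1,…,K}, and every i ∈ {M_k,…,N_k}: max(‖x^{(t+1)}_i − x*_i‖_∞, ‖λ^{(t+1)}_i − λ*_i‖_∞) ≤ ε_{i − M^ω_k} ‖x^{(t)}_{M^ω_k} − x*_{M^ω_k}‖_∞ + ε_{N^ω_k − i} ‖λ^{(t)}_{N^ω_k} − λ*_{N^ω_k}‖_∞. Then for every t ≥ 0: max_{i ∈ {M,…,N}} max(‖x^{(t)}_i − x*_i‖_∞, ‖λ^{(t)}_i − λ*_i‖_∞) ≤ (2 ε_ω)^t · max_{i ∈ {M,…,N}} max(‖x^{(0)}_i − x*_i‖_∞, ‖λ^{(0)}_i − λ*_i‖_∞). In particular, if 2ε_ω < 1 the iterates converge to (x*, λ*). -/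
open Filter

/-- Consecutive integer intervals `[a k, b k]`, `1 ≤ k ≤ K`, cover `[a 1, b K]`. -/
theorem exists_mem_consecutive_block {K : ℕ} (hK : 1 ≤ K) {a b : ℕ → ℤ}
    (hconsec : ∀ k, 1 ≤ k → k ≤ K - 1 → a (k + 1) = b k + 1) {i : ℤ}
    (hi : a 1 ≤ i) (hiK : i ≤ b K) : ∃ k, 1 ≤ k ∧ k ≤ K ∧ a k ≤ i ∧ i ≤ b k := by
  induction K, hK using Nat.le_induction with
  | base => exact ⟨1, le_rfl, le_rfl, hi, hiK⟩
  | succ K hK ih =>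
    by_cases h : i ≤ b K
    · obtain ⟨k, hk, hkK, hki⟩ := ih (fun k hk hkK => hconsec k hk (by omega)) h
      exact ⟨k, hk, by omega, hki⟩
    · have := hconsec K hK (by omega)
      exact ⟨K + 1, by omega, le_rfl, by omega, hiK⟩

/-- abstract convergence of the overlapping decomposition scheme:
if the boundary values are fixed and each sweep satisfies the ADS-type contraction
estimate on every block, then the worst-case primal-dual error contracts by the
factor `2 ε ω` at each iteration; in particular, if `2 ε ω < 1` the iterates converge. -/
theorem decomposition_contraction
    (nx : ℕ) (hnx : 1 ≤ nx) (M N : ℤ) (hMN : M < N)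
    (K : ℕ) (hK : 1 ≤ K) (Mk Nk : ℕ → ℤ)
    (hM1 : Mk 1 = M) (hNK : Nk K = N)
    (hblock : ∀ k, 1 ≤ k → k ≤ K → Mk k ≤ Nk k)
    (hconsec : ∀ k, 1 ≤ k → k ≤ K - 1 → Mk (k+1) = Nk k + 1)
    (ω : ℕ) (hω : 1 ≤ ω)
    (Mω Nω : ℕ → ℤ)
    (hMω : ∀ k, Mω k = max (Mk k - ω) M) (hNω : ∀ k, Nω k = min (Nk k + ω) N)
    (ε : ℕ → ℝ) (hεnn : ∀ n, 0 ≤ ε n) (hεmono : Antitone ε)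
    (xs ls : ℤ → Fin nx → ℝ)
    (x l : ℕ → ℤ → Fin nx → ℝ)
    (hinit : ∀ t, x t M = xs M ∧ l t N = ls N)
    (hcontract : ∀ t, ∀ k, 1 ≤ k → k ≤ K → ∀ i, Mk k ≤ i → i ≤ Nk k →
      max ‖x (t+1) i - xs i‖ ‖l (t+1) i - ls i‖ ≤
        ε (i - Mω k).toNat * ‖x t (Mω k) - xs (Mω k)‖
        + ε (Nω k - i).toNat * ‖l t (Nω k) - ls (Nω k)‖) :
    (∀ t : ℕ, ∀ i, M ≤ i → i ≤ N →
      max ‖x t i - xs i‖ ‖l t i - ls i‖ ≤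
        (2 * ε ω) ^ t *
          (Finset.Icc M N).sup' (Finset.nonempty_Icc.mpr hMN.le)
            (fun j => max ‖x 0 j - xs j‖ ‖l 0 j - ls j‖)) ∧
    (2 * ε ω < 1 → ∀ i, M ≤ i → i ≤ N →
      Tendsto (fun t => max ‖x t i - xs i‖ ‖l t i - ls i‖) atTop (nhds 0)) := by
  have hstep : ∀ (t : ℕ) (C : ℝ),
      (∀ j, M ≤ j → j ≤ N → max ‖x t j - xs j‖ ‖l t j - ls j‖ ≤ C) →
      ∀ i, M ≤ i → i ≤ N →
        max ‖x (t + 1) i - xs i‖ ‖l (t + 1) i - ls i‖ ≤ 2 * ε ω * C := by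
    intro t C hC i hMi hiN
    have hC0 : 0 ≤ C := (norm_nonneg _).trans ((le_max_left _ _).trans (hC i hMi hiN))
    obtain ⟨k, hk, hkK, hki, hik⟩ :=
      exists_mem_consecutive_block hK hconsec (hM1.trans_le hMi) (hiN.trans_eq hNK.symm)
    have hleft : ε (i - Mω k).toNat * ‖x t (Mω k) - xs (Mω k)‖ ≤ ε ω * C := by
      have hMk := hMω k
      rcases le_total (Mk k - ω) M with h | h
      · rw [max_eq_right h] at hMk
        rw [hMk, (hinit t).1, sub_self, norm_zero, mul_zero]
        exact mul_nonneg (hεnn ω) hC0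
      · rw [max_eq_left h] at hMk
        exact mul_le_mul (hεmono (by omega))
          ((le_max_left _ _).trans (hC _ (by omega) (by omega))) (norm_nonneg _) (hεnn ω)
    have hright : ε (Nω k - i).toNat * ‖l t (Nω k) - ls (Nω k)‖ ≤ ε ω * C := by
      have hNk := hNω k
      rcases le_total N (Nk k + ω) with h | h
      · rw [min_eq_right h] at hNk
        rw [hNk, (hinit t).2, sub_self, norm_zero, mul_zero]
        exact mul_nonneg (hεnn ω) hC0
      · rw [min_eq_left h] at hNk
        exact mul_le_mul (hεmono (by omega))
          ((le_max_right _ _).trans (hC _ (by omega) (by omega))) (norm_nonneg _) (hεnn ω)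
    linarith [hcontract t k hk hkK i hki hik]
  have hbound : ∀ t : ℕ, ∀ i, M ≤ i → i ≤ N →
      max ‖x t i - xs i‖ ‖l t i - ls i‖ ≤
        (2 * ε ω) ^ t *
          (Finset.Icc M N).sup' (Finset.nonempty_Icc.mpr hMN.le)
            (fun j => max ‖x 0 j - xs j‖ ‖l 0 j - ls j‖) := by
    intro t
    induction t with
    | zero =>
      intro i hMi hiN
      rw [pow_zero, one_mul]
      exact Finset.le_sup' (fun j => max ‖x 0 j - xs j‖ ‖l 0 j - ls j‖)
        (Finset.mem_Icc.mpr ⟨hMi, hiN⟩)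
    | succ t ih =>
      intro i hMi hiN
      rw [pow_succ', mul_assoc]
      exact hstep t _ ih i hMi hiN
  refine ⟨hbound, fun h i hMi hiN => ?_⟩
  refine squeeze_zero (fun t => (norm_nonneg _).trans (le_max_left _ _))
    (fun t => hbound t i hMi hiN) ?_
  simpa using (tendsto_pow_atTop_nhds_zero_of_lt_one
    (mul_nonneg zero_le_two (hεnn ω)) h).mul_const _
end

section
/- (Asymptotic decay of sensitivity for linear-quadratic problems.) There exist constants C > 0 and ρ ∈ (0,1), depending only on n_x, A, b, Q, r (and in particular independent of the horizon length N and of the boundary data), such that the following holds: for every integer N ≥ 2, all boundary data (x*, λ*) and (x̃*, λ̃*) in ℝ^{n_x} × ℝ^{n_x}, every KKT trajectory (x, u, λ) of P_{1:N}(x*, λ*) and every KKT trajectory (x̃, ũ, λ̃) of P_{1:N}(x̃*, λ̃*), one has for all i ∈ {1,…,N}: max(‖x_i − x̃_i‖_∞, ‖λ_i − λ̃_i‖_∞) ≤ C ρ^{i−1} ‖x* − x̃*‖_∞ + C ρ^{N−i} ‖λ* − λ̃*‖_∞. -/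
open Matrix

/-- The controllability matrix `[b, Ab, …, A^{n_x−1}b]`. -/
def ctrbMat {nx : ℕ} (A : Matrix (Fin nx) (Fin nx) ℝ) (b : Fin nx → ℝ) :
    Matrix (Fin nx) (Fin nx) ℝ :=
  Matrix.of fun i j => ((A ^ (j : ℕ)) *ᵥ b) i

/-- KKT trajectory of the linear-quadratic problem `P_{M:N}(xs, ls)` with stage cost
`xᵀQx − fᵀx + r u²`, dynamics `x⁺ = Ax + bu + c`, initial state `xs` and
terminal cost gradient `ls`. -/
def LQKKT {nx : ℕ} (A Q : Matrix (Fin nx) (Fin nx) ℝ) (b f c : Fin nx → ℝ) (r : ℝ)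
    (M N : ℤ) (xs ls : Fin nx → ℝ)
    (x : ℤ → Fin nx → ℝ) (u : ℤ → ℝ) (lam : ℤ → Fin nx → ℝ) : Prop :=
  x M = xs ∧ lam N = ls ∧
  (∀ i, M ≤ i → i < N → x (i+1) = A *ᵥ x i + u i • b + c) ∧
  (∀ i, M ≤ i → i < N → lam i = (2:ℝ) • (Q *ᵥ x i) - f + Aᵀ *ᵥ lam (i+1)) ∧
  (∀ i, M ≤ i → i < N → 2 * r * u i + b ⬝ᵥ lam (i+1) = 0)


section

variable {n : ℕ}

/-- The linear part of the KKT system, indexed by `ℕ` and with the stages starting at `0`. -/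
def HomKKT (A Q : Matrix (Fin n) (Fin n) ℝ) (b : Fin n → ℝ) (r : ℝ) (M : ℕ)
    (x : ℕ → Fin n → ℝ) (u : ℕ → ℝ) (lam : ℕ → Fin n → ℝ) : Prop :=
  ∀ i < M, x (i + 1) = A *ᵥ x i + u i • b ∧
    lam i = (2 : ℝ) • (Q *ᵥ x i) + Aᵀ *ᵥ lam (i + 1) ∧ 2 * r * u i + b ⬝ᵥ lam (i + 1) = 0

theorem abs_dotProduct_le (x y : Fin n → ℝ) : |x ⬝ᵥ y| ≤ n * (‖x‖ * ‖y‖) := by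
  calc |x ⬝ᵥ y| ≤ ∑ i, |x i * y i| := Finset.abs_sum_le_sum_abs _ _
    _ ≤ ∑ _i : Fin n, ‖x‖ * ‖y‖ := by
        refine Finset.sum_le_sum fun i _ => ?_
        rw [abs_mul]
        exact mul_le_mul (norm_le_pi_norm x i) (norm_le_pi_norm y i) (abs_nonneg _) (norm_nonneg _)
    _ = n * (‖x‖ * ‖y‖) := by simp

theorem sq_norm_le_dotProduct_self (x : Fin n → ℝ) : ‖x‖ ^ 2 ≤ x ⬝ᵥ x := by
  have h0 : 0 ≤ x ⬝ᵥ x := Finset.sum_nonneg fun i _ => mul_self_nonneg (x i)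
  refine (Real.le_sqrt (norm_nonneg _) h0).1 ((pi_norm_le_iff_of_nonneg (Real.sqrt_nonneg _)).2 ?_)
  intro i
  refine Real.le_sqrt_of_sq_le ?_
  rw [Real.norm_eq_abs, sq_abs, sq]
  exact Finset.single_le_sum (f := fun i => x i * x i) (fun i _ => mul_self_nonneg (x i))
    (Finset.mem_univ i)

theorem exists_norm_mulVec_le (A : Matrix (Fin n) (Fin n) ℝ) :
    ∃ K, 0 ≤ K ∧ ∀ x, ‖A *ᵥ x‖ ≤ K * ‖x‖ :=
  ⟨_, norm_nonneg _, fun x => (LinearMap.toContinuousLinearMap (Matrix.mulVecLin A)).le_opNorm x⟩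

theorem Matrix.PosDef.exists_mul_sq_norm_le {Q : Matrix (Fin n) (Fin n) ℝ} (hQ : Q.PosDef)
    (hn : 1 ≤ n) : ∃ c, 0 < c ∧ ∀ x, c * ‖x‖ ^ 2 ≤ x ⬝ᵥ Q *ᵥ x := by
  have : NeZero n := ⟨by omega⟩
  have hpos : ∀ x : Fin n → ℝ, x ≠ 0 → 0 < x ⬝ᵥ Q *ᵥ x := fun x hx => by
    simpa using hQ.dotProduct_mulVec_pos hx
  have hcont : Continuous fun x : Fin n → ℝ => x ⬝ᵥ Q *ᵥ x := by
    fun_prop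
  obtain ⟨z, hz, hmin⟩ := (isCompact_sphere (0 : Fin n → ℝ) 1).exists_isMinOn
    (NormedSpace.sphere_nonempty.2 zero_le_one) hcont.continuousOn
  have hz0 : z ≠ 0 := by
    rintro rfl
    simp at hz
  refine ⟨_, hpos z hz0, fun x => ?_⟩
  rcases eq_or_ne x 0 with rfl | hx
  · simp
  have hx' : 0 < ‖x‖ := norm_pos_iff.2 hx
  have h := isMinOn_iff.1 hmin (‖x‖⁻¹ • x) (by simp [norm_smul, hx'.ne'])
  simp only [mulVec_smul, smul_dotProduct, dotProduct_smul, smul_eq_mul] at h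
  calc _ ≤ ‖x‖⁻¹ * (‖x‖⁻¹ * (x ⬝ᵥ Q *ᵥ x)) * ‖x‖ ^ 2 := by gcongr
    _ = _ := by field_simp

section

variable {A Q : Matrix (Fin n) (Fin n) ℝ} {b : Fin n → ℝ} {r : ℝ}

theorem HomKKT.dotProduct_eq {M : ℕ} {x : ℕ → Fin n → ℝ} {u : ℕ → ℝ} {lam : ℕ → Fin n → ℝ}
    (h : HomKKT A Q b r M x u lam) {i : ℕ} (hi : i < M) (y : Fin n → ℝ) (v : ℝ) :
    y ⬝ᵥ lam i = 2 * (y ⬝ᵥ Q *ᵥ x i) + 2 * r * v * u i + (A *ᵥ y + v • b) ⬝ᵥ lam (i + 1) := by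
  obtain ⟨-, h2, h3⟩ := h i hi
  rw [h2, dotProduct_add, add_dotProduct, dotProduct_smul, smul_dotProduct,
    dotProduct_mulVec y Aᵀ, vecMul_transpose, smul_eq_mul, smul_eq_mul]
  linear_combination (-v) * h3

theorem HomKKT.sub {M : ℕ} {x x' : ℕ → Fin n → ℝ} {u u' : ℕ → ℝ} {lam lam' : ℕ → Fin n → ℝ}
    (h : HomKKT A Q b r M x u lam) (h' : HomKKT A Q b r M x' u' lam') :
    HomKKT A Q b r M (x - x') (u - u') (lam - lam') := by
  intro i hi
  obtain ⟨h1, h2, h3⟩ := h i hi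
  obtain ⟨h1', h2', h3'⟩ := h' i hi
  refine ⟨?_, ?_, ?_⟩
  · simp only [Pi.sub_apply, h1, h1', mulVec_sub, sub_smul]
    abel
  · simp only [Pi.sub_apply, mulVec_sub, smul_sub]
    rw [h2, h2']
    abel
  · simp only [Pi.sub_apply, dotProduct_sub]
    linear_combination h3 - h3'

/-- One step of the Riccati recursion. -/
theorem exists_riccati_step (hQ : ∀ x, 0 ≤ x ⬝ᵥ Q *ᵥ x) (hr : 0 < r)
    (P : Matrix (Fin n) (Fin n) ℝ) (hP : ∀ x, 0 ≤ x ⬝ᵥ P *ᵥ x) :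
    ∃ P' : Matrix (Fin n) (Fin n) ℝ, (∀ x, 0 ≤ x ⬝ᵥ P' *ᵥ x) ∧ ∀ x, ∃ v : ℝ,
      P' *ᵥ x = (2 : ℝ) • (Q *ᵥ x) + Aᵀ *ᵥ P *ᵥ (A *ᵥ x + v • b) ∧
      2 * r * v + b ⬝ᵥ P *ᵥ (A *ᵥ x + v • b) = 0 := by
  set d : ℝ := 2 * r + b ⬝ᵥ P *ᵥ b with hd_def
  have hd : 0 < d := by have := hP b; positivity
  set g : Fin n → ℝ := (-d⁻¹) • (b ᵥ* (P * A)) with hg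
  have key : ∀ x, 2 * r * (g ⬝ᵥ x) + b ⬝ᵥ P *ᵥ (A *ᵥ x + (g ⬝ᵥ x) • b) = 0 := by
    intro x
    have hgx : g ⬝ᵥ x = -d⁻¹ * (b ⬝ᵥ P *ᵥ A *ᵥ x) := by
      rw [hg, smul_dotProduct, smul_eq_mul, ← dotProduct_mulVec, mulVec_mulVec]
    rw [mulVec_add, dotProduct_add, mulVec_smul, dotProduct_smul, smul_eq_mul]
    have : d * (g ⬝ᵥ x) = -(b ⬝ᵥ P *ᵥ A *ᵥ x) := by rw [hgx]; field_simp
    rw [hd_def] at this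
    linear_combination this
  have keyP : ∀ x, ((2 : ℝ) • Q + Aᵀ * P * (A + vecMulVec b g)) *ᵥ x =
      (2 : ℝ) • (Q *ᵥ x) + Aᵀ *ᵥ P *ᵥ (A *ᵥ x + (g ⬝ᵥ x) • b) := by
    intro x
    rw [add_mulVec, smul_mulVec, ← mulVec_mulVec, ← mulVec_mulVec, add_mulVec, vecMulVec_mulVec]
    simp
  refine ⟨_, fun x => ?_, fun x => ⟨g ⬝ᵥ x, keyP x, key x⟩⟩
  have hk := key x
  rw [keyP, dotProduct_add, dotProduct_smul, dotProduct_mulVec x Aᵀ, vecMul_transpose, smul_eq_mul]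
  generalize g ⬝ᵥ x = v at hk
  have h1 := hP (A *ᵥ x + v • b)
  rw [add_dotProduct, smul_dotProduct, smul_eq_mul] at h1
  have h2 : v * (b ⬝ᵥ P *ᵥ (A *ᵥ x + v • b)) = -(2 * r * v ^ 2) := by
    linear_combination v * hk
  have h3 : 0 ≤ 2 * r * v ^ 2 := by positivity
  linarith [hQ x]

theorem exists_homKKT (hQ : ∀ x, 0 ≤ x ⬝ᵥ Q *ᵥ x) (hr : 0 < r) (M : ℕ) :
    ∃ P : Matrix (Fin n) (Fin n) ℝ, (∀ x, 0 ≤ x ⬝ᵥ P *ᵥ x) ∧ ∀ x0, ∃ x u lam,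
      HomKKT A Q b r M x u lam ∧ x 0 = x0 ∧ lam M = 0 ∧ lam 0 = P *ᵥ x0 := by
  induction M with
  | zero => exact ⟨0, by simp, fun x0 => ⟨fun _ => x0, 0, 0, by simp [HomKKT]⟩⟩
  | succ M ih =>
    obtain ⟨P, hP, ih⟩ := ih
    obtain ⟨P', hP', h⟩ := exists_riccati_step (A := A) (b := b) hQ hr P hP
    refine ⟨P', hP', fun x0 => ?_⟩
    obtain ⟨v, hv1, hv2⟩ := h x0
    obtain ⟨x, u, lam, hk, hx0, hlM, hl0⟩ := ih (A *ᵥ x0 + v • b)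
    refine ⟨fun i => i.casesOn x0 x, fun i => i.casesOn v u,
      fun i => i.casesOn (P' *ᵥ x0) lam, ?_, rfl, hlM, rfl⟩
    rintro (_ | i) hi
    · change x 0 = A *ᵥ x0 + v • b ∧ P' *ᵥ x0 = (2 : ℝ) • (Q *ᵥ x0) + Aᵀ *ᵥ lam 0 ∧
        2 * r * v + b ⬝ᵥ lam 0 = 0
      rw [hx0, hl0]
      exact ⟨rfl, hv1, hv2⟩
    · exact hk i (by omega)

/-- Controllability: every state can be steered to the origin in `n` steps, at a cost controlled
by its norm. -/
theorem exists_deadbeat (hctrb : IsUnit (ctrbMat A b)) :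
    ∃ K, 0 ≤ K ∧ ∀ w : Fin n → ℝ, ∃ (y : ℕ → Fin n → ℝ) (v : ℕ → ℝ), y 0 = w ∧
      (∀ k, y (k + 1) = A *ᵥ y k + v k • b) ∧ y n = 0 ∧
      ∀ k ≤ n, ‖y k‖ ≤ K * ‖w‖ ∧ |v k| ≤ K * ‖w‖ := by
  obtain ⟨a, ha0, ha⟩ := exists_norm_mulVec_le A
  obtain ⟨q, hq0, hq⟩ := exists_norm_mulVec_le (-((ctrbMat A b)⁻¹ * A ^ n))
  let z : (Fin n → ℝ) → Fin n → ℝ := fun w => (-((ctrbMat A b)⁻¹ * A ^ n)) *ᵥ w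
  let v : (Fin n → ℝ) → ℕ → ℝ := fun w k =>
    if h : n - 1 - k < n then z w ⟨n - 1 - k, h⟩ else 0
  let y : (Fin n → ℝ) → ℕ → Fin n → ℝ := fun w k =>
    Nat.rec w (fun j yj => A *ᵥ yj + v w j • b) k
  have hv : ∀ w k, |v w k| ≤ q * ‖w‖ := by
    intro w k
    simp only [v]
    split_ifs with h
    · exact (norm_le_pi_norm (z w) _).trans (hq w)
    · simpa using by positivity
  have hy : ∀ k, ∃ K, 0 ≤ K ∧ ∀ w, ‖y w k‖ ≤ K * ‖w‖ := by
    intro k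
    induction k with
    | zero => exact ⟨1, zero_le_one, fun w => by simp [y]⟩
    | succ k ih =>
      obtain ⟨K, hK, ih⟩ := ih
      refine ⟨a * K + q * ‖b‖, by positivity, fun w => ?_⟩
      calc ‖A *ᵥ y w k + v w k • b‖ ≤ ‖A *ᵥ y w k‖ + |v w k| * ‖b‖ := by
            rw [← Real.norm_eq_abs, ← norm_smul]; exact norm_add_le _ _
        _ ≤ a * (K * ‖w‖) + q * ‖w‖ * ‖b‖ := by
            gcongr
            · exact (ha _).trans (by gcongr; exact ih w)
            · exact hv w k
        _ = _ := by ring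
  choose K hK0 hK using hy
  have hform : ∀ w k, y w k =
      A ^ k *ᵥ w + ∑ j ∈ Finset.range k, v w j • (A ^ (k - 1 - j) *ᵥ b) := by
    intro w k
    induction k with
    | zero => simp [y]
    | succ k ih =>
      change A *ᵥ y w k + v w k • b = _
      rw [ih, Finset.sum_range_succ, mulVec_add, mulVec_mulVec, ← pow_succ', mulVec_sum, add_assoc]
      congr 1
      congr 1
      · refine Finset.sum_congr rfl fun j hj => ?_
        have := Finset.mem_range.1 hj
        rw [mulVec_smul, mulVec_mulVec, ← pow_succ']
        congr 4
        omega
      · simp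
  refine ⟨q + ∑ k ∈ Finset.range (n + 1), K k, ?_, fun w => ⟨y w, v w, rfl, fun _ => rfl, ?_, ?_⟩⟩
  · exact add_nonneg hq0 (Finset.sum_nonneg fun k _ => hK0 k)
  · have hsum : ∑ j ∈ Finset.range n, v w j • (A ^ (n - 1 - j) *ᵥ b) = ctrbMat A b *ᵥ z w := by
      rw [← Finset.sum_range_reflect, ← Fin.sum_univ_eq_sum_range
        (fun j => v w (n - 1 - j) • (A ^ (n - 1 - (n - 1 - j)) *ᵥ b))]
      ext i
      simp only [mulVec, dotProduct, Finset.sum_apply]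
      refine Finset.sum_congr rfl fun j _ => ?_
      have hj : n - 1 - (n - 1 - (j : ℕ)) = j := by omega
      simp [v, hj, ctrbMat, mul_comm, mulVec, dotProduct]
    rw [hform, hsum]
    simp only [z]
    rw [mulVec_mulVec, mul_neg, mul_nonsing_inv_cancel_left _ _
      ((Matrix.isUnit_iff_isUnit_det _).1 hctrb), neg_mulVec, add_neg_cancel]
  · intro k hk
    have hs : 0 ≤ ∑ k ∈ Finset.range (n + 1), K k := Finset.sum_nonneg fun k _ => hK0 k
    have hk' : K k ≤ ∑ k ∈ Finset.range (n + 1), K k :=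
      Finset.single_le_sum (fun k _ => hK0 k) (Finset.mem_range.2 (by omega))
    exact ⟨(hK k w).trans (by gcongr; linarith), (hv w k).trans (by gcongr; linarith)⟩

/-- Dissipation inequalities for a storage function `V` along a trajectory with state norms `X` and
costate norms `L`, where `n` is the length of an observation window. -/
structure DissipationEstimates (K : ℝ) (n M : ℕ) (V X L : ℕ → ℝ) : Prop where
  state : ∀ i < M, X i ^ 2 ≤ K * (V i - V (i + 1))
  state_succ : ∀ i < M, X (i + 1) ^ 2 ≤ K * (V i - V (i + 1))
  storage : ∀ i, |V i| ≤ K * (X i * L i)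
  costate : ∀ m k, k ≤ n → m + k ≤ M → ∀ s, 0 ≤ s → (k < n → L (m + k) ^ 2 ≤ s) →
    L m ^ 2 ≤ K * (V m - V (m + k) + s)

theorem HomKKT.exists_dissipationEstimates (hn : 1 ≤ n) (hQ : Q.PosDef) (hr : 0 < r)
    (hctrb : IsUnit (ctrbMat A b)) :
    ∃ K, 1 ≤ K ∧ ∀ (M : ℕ) (x : ℕ → Fin n → ℝ) (u : ℕ → ℝ) (lam : ℕ → Fin n → ℝ),
      HomKKT A Q b r M x u lam →
      DissipationEstimates K n M (fun i => x i ⬝ᵥ lam i) (fun i => ‖x i‖) (fun i => ‖lam i‖) := by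
  obtain ⟨c, hc, hcQ⟩ := hQ.exists_mul_sq_norm_le hn
  obtain ⟨a, ha0, ha⟩ := exists_norm_mulVec_le A
  obtain ⟨q, hq0, hq⟩ := exists_norm_mulVec_le Q
  obtain ⟨κ, hκ0, hκ⟩ := exists_deadbeat hctrb
  have hn0 : (0 : ℝ) < n := by exact_mod_cast hn
  set d : ℝ := min c r with hd_def
  have hd : 0 < d := lt_min hc hr
  set T : ℝ := κ * (2 * n * q + 2 * r) with hT
  set B : ℝ := 2 * n * T ^ 2 / d with hB_def
  have hB : 0 ≤ B := by positivity
  set K : ℝ := 1 + 1 / d + 2 * (a ^ 2 + ‖b‖ ^ 2) / d + n + 2 * B + 2 * (n ^ 2 * κ ^ 2) with hK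
  have p1 : 0 ≤ 1 / d := by positivity
  have p2 : 0 ≤ 2 * (a ^ 2 + ‖b‖ ^ 2) / d := by positivity
  have p3 : 0 ≤ 2 * ((n : ℝ) ^ 2 * κ ^ 2) := by positivity
  refine ⟨K, by linarith, fun M x u lam h => ?_⟩
  have hdiss : ∀ i < M, d * (‖x i‖ ^ 2 + u i ^ 2) ≤ x i ⬝ᵥ lam i - x (i + 1) ⬝ᵥ lam (i + 1) := by
    intro i hi
    have h1 := h.dotProduct_eq hi (x i) (u i)
    rw [← (h i hi).1] at h1
    have h2 := hcQ (x i)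
    have h3 : d * ‖x i‖ ^ 2 ≤ c * ‖x i‖ ^ 2 := by gcongr; exact min_le_left _ _
    have h4 : d * u i ^ 2 ≤ r * u i ^ 2 := by gcongr; exact min_le_right _ _
    have h5 : 0 ≤ c * ‖x i‖ ^ 2 := by positivity
    have h6 : 0 ≤ r * u i ^ 2 := by positivity
    have h7 : 2 * r * u i * u i = 2 * (r * u i ^ 2) := by ring
    linarith
  have hdiss' : ∀ i < M, ‖x i‖ ^ 2 + u i ^ 2 ≤
      1 / d * (x i ⬝ᵥ lam i - x (i + 1) ⬝ᵥ lam (i + 1)) := by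
    intro i hi
    rw [one_div_mul_eq_div, le_div_iff₀' hd]
    exact hdiss i hi
  have hV : ∀ i < M, 0 ≤ x i ⬝ᵥ lam i - x (i + 1) ⬝ᵥ lam (i + 1) := fun i hi =>
    le_trans (by positivity) (hdiss i hi)
  refine ⟨fun i hi => ?_, fun i hi => ?_, fun i => ?_, fun m k hkn hkM s hs hls => ?_⟩
  · calc ‖x i‖ ^ 2 ≤ ‖x i‖ ^ 2 + u i ^ 2 := by linarith [sq_nonneg (u i)]
      _ ≤ _ := hdiss' i hi
      _ ≤ _ := mul_le_mul_of_nonneg_right (by linarith) (hV i hi)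
  · have h1 : ‖x (i + 1)‖ ≤ a * ‖x i‖ + |u i| * ‖b‖ := by
      rw [(h i hi).1, ← Real.norm_eq_abs, ← norm_smul]
      exact (norm_add_le _ _).trans (by gcongr; exact ha _)
    calc ‖x (i + 1)‖ ^ 2 ≤ (a * ‖x i‖ + |u i| * ‖b‖) ^ 2 := by gcongr
      _ ≤ 2 * (a ^ 2 + ‖b‖ ^ 2) * (‖x i‖ ^ 2 + u i ^ 2) := by
          rw [← sq_abs (u i)]
          nlinarith [sq_nonneg (a * ‖x i‖ - |u i| * ‖b‖), sq_nonneg (a * |u i|),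
            sq_nonneg (‖b‖ * ‖x i‖)]
      _ ≤ 2 * (a ^ 2 + ‖b‖ ^ 2) * (1 / d * (x i ⬝ᵥ lam i - x (i + 1) ⬝ᵥ lam (i + 1))) := by
          gcongr
          exact hdiss' i hi
      _ = 2 * (a ^ 2 + ‖b‖ ^ 2) / d * (x i ⬝ᵥ lam i - x (i + 1) ⬝ᵥ lam (i + 1)) := by ring
      _ ≤ _ := mul_le_mul_of_nonneg_right (by linarith) (hV i hi)
  · exact (abs_dotProduct_le _ _).trans (mul_le_mul_of_nonneg_right (by linarith) (by positivity))
  · obtain ⟨y, v, hy0, hy, hyn, hyv⟩ := hκ (lam m)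
    set w := ‖lam m‖ with hw
    have hstep : ∀ j ≤ n, ∀ i < M,
        2 * (y j ⬝ᵥ Q *ᵥ x i) + 2 * r * v j * u i ≤
          w ^ 2 / (4 * n) + B * (x i ⬝ᵥ lam i - x (i + 1) ⬝ᵥ lam (i + 1)) := by
      intro j hj i hi
      obtain ⟨hyj, hvj⟩ := hyv j hj
      have h1 : y j ⬝ᵥ Q *ᵥ x i ≤ n * (κ * w * (q * ‖x i‖)) :=
        (le_abs_self _).trans ((abs_dotProduct_le _ _).trans (by gcongr; exact hq _))
      have h2 : v j * u i ≤ κ * w * |u i| :=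
        (le_abs_self _).trans (by rw [abs_mul]; gcongr)
      have hqx : 0 ≤ κ * w * ‖x i‖ := by positivity
      have hru : 0 ≤ κ * w * |u i| := by positivity
      have h3 : 2 * (y j ⬝ᵥ Q *ᵥ x i) + 2 * r * v j * u i ≤ w * (T * ‖x i‖) + w * (T * |u i|) := by
        have e1 : 2 * r * v j * u i ≤ 2 * r * (κ * w * |u i|) := by
          rw [mul_assoc (2 * r)]; gcongr
        have e2 : 0 ≤ 2 * r * (κ * w * ‖x i‖) := by positivity
        have e3 : 0 ≤ 2 * n * q * (κ * w * |u i|) := by positivity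
        rw [hT]
        linarith
      have young : ∀ p : ℝ, w * p ≤ w ^ 2 / (8 * n) + 2 * n * p ^ 2 := by
        intro p
        have : w ^ 2 / (8 * n) + 2 * n * p ^ 2 - w * p = (w - 4 * n * p) ^ 2 / (8 * n) := by
          field_simp
          ring
        have : 0 ≤ (w - 4 * n * p) ^ 2 / (8 * n) := by positivity
        linarith
      have h4 : 2 * n * T ^ 2 * (‖x i‖ ^ 2 + u i ^ 2) ≤
          B * (x i ⬝ᵥ lam i - x (i + 1) ⬝ᵥ lam (i + 1)) := by
        calc _ ≤ 2 * n * T ^ 2 * (1 / d * (x i ⬝ᵥ lam i - x (i + 1) ⬝ᵥ lam (i + 1))) := by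
              gcongr
              exact hdiss' i hi
          _ = _ := by rw [hB_def]; ring
      have h5 := young (T * ‖x i‖)
      have h6 := young (T * |u i|)
      have h7 : w ^ 2 / (4 * n) = 2 * (w ^ 2 / (8 * n)) := by ring
      rw [mul_pow, sq_abs] at h6
      rw [mul_pow] at h5
      linarith
    have hsum : ∀ j, j ≤ n → m + j ≤ M → lam m ⬝ᵥ lam m ≤
        j * (w ^ 2 / (4 * n)) + B * (x m ⬝ᵥ lam m - x (m + j) ⬝ᵥ lam (m + j)) +
          y j ⬝ᵥ lam (m + j) := by
      intro j
      induction j with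
      | zero => intro _ _; simp [hy0]
      | succ j ih =>
        intro h1 h2
        have h3 := ih (by omega) (by omega)
        have h4 := hstep j (by omega) (m + j) (by omega)
        have h5 := h.dotProduct_eq (i := m + j) (by omega) (y j) (v j)
        rw [← hy] at h5
        push_cast
        rw [← add_assoc m j 1]
        linarith
    have hend : y k ⬝ᵥ lam (m + k) ≤ w ^ 2 / 4 + n ^ 2 * κ ^ 2 * s := by
      rcases hkn.eq_or_lt with rfl | hlt
      · rw [hyn, zero_dotProduct]
        positivity
      · have h1 : y k ⬝ᵥ lam (m + k) ≤ n * (κ * w * ‖lam (m + k)‖) :=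
          (le_abs_self _).trans ((abs_dotProduct_le _ _).trans (by gcongr; exact (hyv k hkn).1))
        have h2 : (n : ℝ) ^ 2 * κ ^ 2 * ‖lam (m + k)‖ ^ 2 ≤ n ^ 2 * κ ^ 2 * s := by
          gcongr
          exact hls hlt
        nlinarith [sq_nonneg (w / 2 - n * κ * ‖lam (m + k)‖)]
    have h1 := hsum k hkn hkM
    have h2 := sq_norm_le_dotProduct_self (lam m)
    have h3 : (k : ℝ) * (w ^ 2 / (4 * n)) ≤ w ^ 2 / 4 := by
      calc (k : ℝ) * (w ^ 2 / (4 * n)) ≤ n * (w ^ 2 / (4 * n)) := by gcongr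
        _ = _ := by field_simp
    have hmono : ∀ j, m + j ≤ M → 0 ≤ x m ⬝ᵥ lam m - x (m + j) ⬝ᵥ lam (m + j) := by
      intro j
      induction j with
      | zero => simp
      | succ j ih =>
        intro h1
        have := ih (by omega)
        have := hV (m + j) (by omega)
        rw [← add_assoc m j 1]
        linarith
    have h4 := hmono k hkM
    calc w ^ 2 ≤ 2 * B * (x m ⬝ᵥ lam m - x (m + k) ⬝ᵥ lam (m + k)) +
          2 * (n ^ 2 * κ ^ 2) * s := by linarith
      _ ≤ K * (x m ⬝ᵥ lam m - x (m + k) ⬝ᵥ lam (m + k)) + K * s := by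
          gcongr <;> linarith
      _ = _ := by ring

end

theorem le_mul_sqrt_pow_mul {C ρ x y : ℝ} (hC : 1 ≤ C) (hρ : 0 ≤ ρ) (hy : 0 ≤ y)
    {k : ℕ} (h : x ^ 2 ≤ C * ρ ^ k * y ^ 2) : x ≤ C * √ρ ^ k * y := by
  refine le_of_sq_le_sq ?_ (by positivity)
  calc x ^ 2 ≤ C * ρ ^ k * y ^ 2 := h
    _ ≤ C ^ 2 * ρ ^ k * y ^ 2 := by gcongr; nlinarith
    _ = C ^ 2 * (√ρ ^ 2) ^ k * y ^ 2 := by rw [Real.sq_sqrt hρ]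
    _ = _ := by ring

theorem sqrt_mem_Ioo {ρ : ℝ} (h0 : 0 < ρ) (h1 : ρ < 1) : √ρ ∈ Set.Ioo (0 : ℝ) 1 :=
  ⟨Real.sqrt_pos.2 h0, (Real.sqrt_lt' one_pos).2 (by simpa using h1)⟩

theorem DissipationEstimates.antitone {K : ℝ} {n M : ℕ} {V X L : ℕ → ℝ} (hK : 1 ≤ K)
    (h : DissipationEstimates K n M V X L) {i j : ℕ} (hij : i ≤ j) (hj : j ≤ M) : V j ≤ V i := by
  induction j, hij using Nat.le_induction with
  | base => exact le_rfl
  | succ j hij ih =>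
    have h1 := (sq_nonneg _).trans (h.state j (by omega))
    have h2 := nonneg_of_mul_nonneg_right h1 (by linarith)
    linarith [ih (by omega)]

/-- Sensitivity with respect to the initial state decays forward in time. -/
theorem exists_forward_decay (K : ℝ) (n : ℕ) (hK : 1 ≤ K) :
    ∃ C, 0 < C ∧ ∃ ρ ∈ Set.Ioo (0 : ℝ) 1, ∀ (M : ℕ) (V X L : ℕ → ℝ), (∀ i, 0 ≤ X i) →
      V M = 0 → L M = 0 → DissipationEstimates K n M V X L →
      ∀ i ≤ M, X i ≤ C * ρ ^ i * X 0 ∧ L i ≤ C * ρ ^ i * X 0 := by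
  set θ : ℝ := K ^ 4 / (1 + K ^ 4) with hθ
  have hK0 : 0 < K := by linarith
  have hθ0 : 0 < θ := by positivity
  have hθ1 : θ < 1 := by rw [hθ, div_lt_one (by positivity)]; linarith
  refine ⟨1 + K ^ 4, by positivity, √θ, sqrt_mem_Ioo hθ0 hθ1, fun M V X L hX hVM hLM h => ?_⟩
  have hC : 1 ≤ 1 + K ^ 4 := by linarith [pow_pos hK0 4]
  have hV0 : ∀ m ≤ M, 0 ≤ V m := fun m hm => hVM ▸ h.antitone hK hm le_rfl
  have hL : ∀ m ≤ M, L m ^ 2 ≤ K * V m := by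
    intro m hm
    have h1 := h.costate m (min n (M - m)) (min_le_left _ _) (by omega) 0 le_rfl (fun hlt => by
      rw [show m + min n (M - m) = M by omega, hLM]; norm_num)
    have h2 := hV0 (m + min n (M - m)) (by omega)
    exact h1.trans (mul_le_mul_of_nonneg_left (by linarith) hK0.le)
  have hVX : ∀ m ≤ M, V m ≤ K ^ 3 * X m ^ 2 := by
    intro m hm
    rcases (hV0 m hm).eq_or_lt with h0 | h0
    · rw [← h0]; positivity
    refine le_of_mul_le_mul_right ?_ h0
    calc V m * V m = |V m| ^ 2 := by rw [sq_abs]; ring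
      _ ≤ (K * (X m * L m)) ^ 2 := by gcongr; exact h.storage m
      _ = K ^ 2 * X m ^ 2 * L m ^ 2 := by ring
      _ ≤ K ^ 2 * X m ^ 2 * (K * V m) := by gcongr; exact hL m hm
      _ = _ := by ring
  have hVθ : ∀ m ≤ M, V m ≤ θ ^ m * V 0 := by
    intro m
    induction m with
    | zero => simp
    | succ m ih =>
      intro hm
      have h1 : V m ≤ K ^ 4 * (V m - V (m + 1)) := by
        calc V m ≤ K ^ 3 * X m ^ 2 := hVX m (by omega)
          _ ≤ K ^ 3 * (K * (V m - V (m + 1))) := by gcongr; exact h.state m hm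
          _ = _ := by ring
      have h2 : V (m + 1) ≤ θ * V m := by
        rw [hθ, div_mul_eq_mul_div, le_div_iff₀ (by positivity)]
        linarith [h.antitone hK (Nat.le_succ m) hm]
      calc V (m + 1) ≤ θ * V m := h2
        _ ≤ θ * (θ ^ m * V 0) := by gcongr; exact ih (by omega)
        _ = _ := by ring
  have hKV : ∀ m ≤ M, K * V m ≤ K ^ 4 * θ ^ m * X 0 ^ 2 := by
    intro m hm
    calc K * V m ≤ K * (θ ^ m * (K ^ 3 * X 0 ^ 2)) := by
          gcongr
          exact (hVθ m hm).trans (by gcongr; exact hVX 0 (by omega))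
      _ = _ := by ring
  intro i hi
  refine ⟨le_mul_sqrt_pow_mul hC hθ0.le (hX 0) ?_, le_mul_sqrt_pow_mul hC hθ0.le (hX 0) ?_⟩
  · rcases i with _ | i
    · rw [pow_zero, mul_one]
      nlinarith [mul_nonneg (pow_nonneg hK0.le 4) (sq_nonneg (X 0))]
    · calc X (i + 1) ^ 2 ≤ K * (V i - V (i + 1)) := h.state_succ i hi
        _ ≤ K * V i := by gcongr; linarith [hV0 (i + 1) hi]
        _ ≤ K ^ 4 * θ ^ i * X 0 ^ 2 := hKV i (by omega)
        _ = (1 + K ^ 4) * θ ^ (i + 1) * X 0 ^ 2 := by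
          have hK4 : (1 + K ^ 4) * θ = K ^ 4 := by rw [hθ]; field_simp
          linear_combination (-(θ ^ i * X 0 ^ 2)) * hK4
  · calc L i ^ 2 ≤ K * V i := hL i hi
      _ ≤ K ^ 4 * θ ^ i * X 0 ^ 2 := hKV i hi
      _ ≤ _ := by gcongr; linarith

/-- Sensitivity with respect to the terminal costate decays backward in time. -/
theorem exists_backward_decay (K : ℝ) (n : ℕ) (hn : 1 ≤ n) (hK : 1 ≤ K) :
    ∃ C, 0 < C ∧ ∃ ρ ∈ Set.Ioo (0 : ℝ) 1, ∀ (M : ℕ) (V X L : ℕ → ℝ), (∀ i, 0 ≤ L i) →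
      V 0 = 0 → X 0 = 0 → DissipationEstimates K n M V X L →
      ∀ i ≤ M, X i ≤ C * ρ ^ (M - i) * L M ∧ L i ≤ C * ρ ^ (M - i) * L M := by
  have hK0 : 0 < K := by linarith
  have hK4 : 1 ≤ K ^ 4 := one_le_pow₀ hK
  have hn1 : (1 : ℝ) ≤ n := by exact_mod_cast hn
  set θ : ℝ := K ^ 4 / (1 + K ^ 4) with hθ
  have hθ0 : 1 / 2 ≤ θ := by
    rw [hθ, div_le_div_iff₀ (by norm_num) (by positivity)]; linarith
  have hθ1 : θ < 1 := by rw [hθ, div_lt_one (by positivity)]; linarith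
  obtain ⟨ρ, hρ0, hρ1, hρn⟩ : ∃ ρ : ℝ, 0 < ρ ∧ ρ < 1 ∧ θ ≤ ρ ^ n := by
    have h1 : 0 < (1 - θ) / n := div_pos (by linarith) (by linarith)
    have h2 : (1 - θ) / n ≤ 1 - θ := div_le_self (by linarith) hn1
    refine ⟨1 + -((1 - θ) / n), by linarith, by linarith, ?_⟩
    refine le_trans (le_of_eq ?_) (one_add_mul_le_pow (by linarith) n)
    field_simp
    ring
  set C : ℝ := 4 * (K ^ 4 + K) with hC_def
  have hC : 1 ≤ C := by linarith
  refine ⟨C, by linarith, √ρ, sqrt_mem_Ioo hρ0 hρ1, fun M V X L hL hV0 hX0 h => ?_⟩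
  have hV : ∀ m ≤ M, V m ≤ 0 := fun m hm => hV0 ▸ h.antitone hK (Nat.zero_le m) hm
  have hX : ∀ m ≤ M, X m ^ 2 ≤ K * -V m := by
    rintro (_ | m) hm
    · simp [hX0, hV0]
    · exact (h.state_succ m hm).trans
        (mul_le_mul_of_nonneg_left (by linarith [hV m (by omega)]) hK0.le)
  have hVL : ∀ m ≤ M, -V m ≤ K ^ 3 * L m ^ 2 := by
    intro m hm
    rcases (hV m hm).eq_or_lt with h0 | h0
    · rw [h0, neg_zero]; positivity
    refine le_of_mul_le_mul_right ?_ (neg_pos.2 h0)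
    calc -V m * -V m = |V m| ^ 2 := by rw [sq_abs]; ring
      _ ≤ (K * (X m * L m)) ^ 2 := by gcongr; exact h.storage m
      _ = K ^ 2 * L m ^ 2 * X m ^ 2 := by ring
      _ ≤ K ^ 2 * L m ^ 2 * (K * -V m) := by gcongr; exact hX m hm
      _ = _ := by ring
  have hfull : ∀ m, m + n ≤ M → L m ^ 2 ≤ K * (V m - V (m + n)) := fun m hm => by
    simpa using h.costate m n le_rfl hm 0 le_rfl (fun hlt => absurd hlt (lt_irrefl n))
  have hwin : ∀ m, m + n ≤ M → -V m ≤ θ * -V (m + n) := by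
    intro m hm
    have h1 : -V m ≤ K ^ 4 * (V m - V (m + n)) := by
      calc -V m ≤ K ^ 3 * L m ^ 2 := hVL m (by omega)
        _ ≤ K ^ 3 * (K * (V m - V (m + n))) := by gcongr; exact hfull m hm
        _ = _ := by ring
    rw [hθ, div_mul_eq_mul_div, le_div_iff₀ (by positivity)]
    linarith
  have hpow : ∀ k ≤ n, θ ≤ ρ ^ k := fun k hk =>
    hρn.trans (pow_le_pow_of_le_one hρ0.le hρ1.le hk)
  have hdecay : ∀ k m, m + k = M → θ * -V m ≤ ρ ^ k * -V M := by
    intro k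
    induction k using Nat.strong_induction_on with
    | _ k ih =>
      intro m hm
      have hVM := hV M le_rfl
      rcases le_or_gt n k with hnk | hnk
      · obtain ⟨j, rfl⟩ := Nat.exists_eq_add_of_le' hnk
        have h1 := ih j (by omega) (m + n) (by omega)
        calc θ * -V m ≤ θ * (θ * -V (m + n)) := by gcongr; exact hwin m (by omega)
          _ ≤ ρ ^ n * (ρ ^ j * -V M) := by
            have : 0 ≤ ρ ^ j * -V M := mul_nonneg (by positivity) (by linarith)
            exact (mul_le_mul_of_nonneg_left h1 (by linarith)).trans
              (mul_le_mul_of_nonneg_right hρn this)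
          _ = _ := by ring
      · have h1 : V M ≤ V m := h.antitone hK (by omega) le_rfl
        calc θ * -V m ≤ θ * -V M := by gcongr
          _ ≤ _ := mul_le_mul_of_nonneg_right (hpow k hnk.le) (by linarith)
  have hdecay' : ∀ k m, m + k = M → -V m ≤ 2 * K ^ 3 * ρ ^ k * L M ^ 2 := by
    intro k m hm
    have h1 := hdecay k m hm
    have h2 : ρ ^ k * -V M ≤ ρ ^ k * (K ^ 3 * L M ^ 2) := by gcongr; exact hVL M le_rfl
    have h3 : 1 / 2 * -V m ≤ θ * -V m :=
      mul_le_mul_of_nonneg_right hθ0 (by linarith [hV m (by omega)])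
    linarith
  intro i hi
  have hp : 0 ≤ ρ ^ (M - i) * L M ^ 2 := by positivity
  refine ⟨le_mul_sqrt_pow_mul hC hρ0.le (hL M) ?_, le_mul_sqrt_pow_mul hC hρ0.le (hL M) ?_⟩
  · calc X i ^ 2 ≤ K * -V i := hX i hi
      _ ≤ K * (2 * K ^ 3 * ρ ^ (M - i) * L M ^ 2) := by
        gcongr
        exact hdecay' _ _ (by omega)
      _ = 2 * K ^ 4 * (ρ ^ (M - i) * L M ^ 2) := by ring
      _ ≤ C * (ρ ^ (M - i) * L M ^ 2) := by gcongr; linarith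
      _ = _ := by ring
  · rcases le_or_gt (i + n) M with hin | hin
    · have hsplit : ρ ^ (M - (i + n)) ≤ 2 * ρ ^ (M - i) := by
        rw [show M - i = n + (M - (i + n)) by omega, pow_add]
        have : 0 < ρ ^ (M - (i + n)) := by positivity
        nlinarith
      calc L i ^ 2 ≤ K * (V i - V (i + n)) := hfull i hin
        _ ≤ K * -V (i + n) := by gcongr; linarith [hV i hi]
        _ ≤ K * (2 * K ^ 3 * ρ ^ (M - (i + n)) * L M ^ 2) := by
          gcongr
          exact hdecay' _ _ (by omega)
        _ ≤ K * (2 * K ^ 3 * (2 * ρ ^ (M - i)) * L M ^ 2) := by gcongr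
        _ = 4 * K ^ 4 * (ρ ^ (M - i) * L M ^ 2) := by ring
        _ ≤ C * (ρ ^ (M - i) * L M ^ 2) := by gcongr; linarith
        _ = _ := by ring
    · have h1 := h.costate i (M - i) (by omega) (by omega) (L M ^ 2) (by positivity)
        (fun _ => by rw [show i + (M - i) = M by omega])
      rw [show i + (M - i) = M by omega] at h1
      have h2 := hpow (M - i) (by omega)
      calc L i ^ 2 ≤ K * (V i - V M + L M ^ 2) := h1
        _ ≤ K * (K ^ 3 * L M ^ 2 + L M ^ 2) := by
          gcongr
          linarith [hV i hi, hVL M le_rfl]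
        _ = (K ^ 4 + K) * L M ^ 2 := by ring
        _ ≤ (K ^ 4 + K) * (2 * ρ ^ (M - i) * L M ^ 2) := by
          gcongr
          exact le_mul_of_one_le_left (sq_nonneg _) (by linarith)
        _ ≤ C * ρ ^ (M - i) * L M ^ 2 := by
          rw [hC_def]
          nlinarith [mul_nonneg (show 0 ≤ K ^ 4 + K by positivity) hp]

/-- Exponential decay of sensitivity for the linear part of the KKT system. -/
theorem HomKKT.exists_decay {A Q : Matrix (Fin n) (Fin n) ℝ} {b : Fin n → ℝ} {r : ℝ} (hn : 1 ≤ n)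
    (hQ : Q.PosDef) (hr : 0 < r) (hctrb : IsUnit (ctrbMat A b)) :
    ∃ C, 0 < C ∧ ∃ ρ ∈ Set.Ioo (0 : ℝ) 1,
      ∀ (M : ℕ) (x : ℕ → Fin n → ℝ) (u : ℕ → ℝ) (lam : ℕ → Fin n → ℝ),
      HomKKT A Q b r M x u lam → ∀ i ≤ M,
        max ‖x i‖ ‖lam i‖ ≤ C * ρ ^ i * ‖x 0‖ + C * ρ ^ (M - i) * ‖lam M‖ := by
  obtain ⟨K, hK, hest⟩ := HomKKT.exists_dissipationEstimates hn hQ hr hctrb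
  obtain ⟨C₁, hC₁, ρ₁, ⟨hρ₁, hρ₁'⟩, hfwd⟩ := exists_forward_decay K n hK
  obtain ⟨C₂, hC₂, ρ₂, ⟨hρ₂, hρ₂'⟩, hbwd⟩ := exists_backward_decay K n hn hK
  refine ⟨max C₁ C₂, lt_max_of_lt_left hC₁, max ρ₁ ρ₂,
    ⟨lt_max_of_lt_left hρ₁, max_lt hρ₁' hρ₂'⟩, fun M x u lam h i hi => ?_⟩
  have hQ0 : ∀ z, 0 ≤ z ⬝ᵥ Q *ᵥ z := fun z => by
    simpa using hQ.posSemidef.dotProduct_mulVec_nonneg z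
  obtain ⟨_, -, hex⟩ := exists_homKKT (A := A) (b := b) hQ0 hr M
  obtain ⟨y, v, μ, hy, hy0, hμM, -⟩ := hex (x 0)
  have hz := h.sub hy
  obtain ⟨f1, f2⟩ := hfwd M _ _ _ (fun i => norm_nonneg (y i)) (by simp [hμM]) (by simp [hμM])
    (hest M y v μ hy) i hi
  obtain ⟨g1, g2⟩ := hbwd M _ _ _ (fun i => norm_nonneg ((lam - μ) i)) (by simp [hy0])
    (by simp [hy0]) (hest M _ _ _ hz) i hi
  simp only [Pi.sub_apply, hμM, sub_zero, hy0] at f1 f2 g1 g2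
  have b1 : C₁ * ρ₁ ^ i * ‖x 0‖ ≤ max C₁ C₂ * max ρ₁ ρ₂ ^ i * ‖x 0‖ := by
    gcongr
    · exact le_max_left _ _
    · exact le_max_left _ _
  have b2 : C₂ * ρ₂ ^ (M - i) * ‖lam M‖ ≤ max C₁ C₂ * max ρ₁ ρ₂ ^ (M - i) * ‖lam M‖ := by
    gcongr
    · exact le_max_right _ _
    · exact le_max_right _ _
  refine max_le ?_ ?_
  · linarith [norm_le_norm_add_norm_sub' (x i) (y i)]
  · linarith [norm_le_norm_add_norm_sub' (lam i) (μ i)]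

theorem LQKKT.homKKT_sub {A Q : Matrix (Fin n) (Fin n) ℝ} {b f c : Fin n → ℝ} {r : ℝ} {N : ℤ}
    {xs ls xs' ls' : Fin n → ℝ} {x x' : ℤ → Fin n → ℝ} {u u' : ℤ → ℝ} {lam lam' : ℤ → Fin n → ℝ}
    (h : LQKKT A Q b f c r 1 N xs ls x u lam) (h' : LQKKT A Q b f c r 1 N xs' ls' x' u' lam') :
    HomKKT A Q b r (N - 1).toNat (fun k => x (k + 1) - x' (k + 1)) (fun k => u (k + 1) - u' (k + 1))
      (fun k => lam (k + 1) - lam' (k + 1)) := by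
  obtain ⟨-, -, h1, h2, h3⟩ := h
  obtain ⟨-, -, h1', h2', h3'⟩ := h'
  intro k hk
  have hk1 : (1 : ℤ) ≤ k + 1 := by omega
  have hk2 : (k : ℤ) + 1 < N := by omega
  push_cast
  refine ⟨?_, ?_, ?_⟩
  · rw [h1 _ hk1 hk2, h1' _ hk1 hk2, mulVec_sub, sub_smul]
    abel
  · rw [h2 _ hk1 hk2, h2' _ hk1 hk2, mulVec_sub, mulVec_sub, smul_sub]
    abel
  · rw [dotProduct_sub]
    linear_combination h3 _ hk1 hk2 - h3' _ hk1 hk2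

end

/-- asymptotic decay of sensitivity for linear-quadratic problems:
there are constants `C > 0`, `ρ ∈ (0,1)` depending only on the problem data (not on the
horizon `N` nor on the boundary data) such that any two KKT trajectories with different
boundary data deviate by at most `C ρ^{i−1} ‖Δx*‖ + C ρ^{N−i} ‖Δλ*‖` at time `i`. -/
theorem lq_asymptotic_decay_of_sensitivity
    (nx : ℕ) (hnx : 1 ≤ nx)
    (Q : Matrix (Fin nx) (Fin nx) ℝ) (hQ : Q.PosDef) (r : ℝ) (hr : 0 < r)
    (A : Matrix (Fin nx) (Fin nx) ℝ) (b : Fin nx → ℝ)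
    (hctrb : IsUnit (ctrbMat A b)) (f c : Fin nx → ℝ) :
    ∃ C : ℝ, 0 < C ∧ ∃ ρ : ℝ, ρ ∈ Set.Ioo (0:ℝ) 1 ∧
      ∀ N : ℤ, 2 ≤ N →
      ∀ xs ls xs' ls' : Fin nx → ℝ,
      ∀ (x : ℤ → Fin nx → ℝ) (u : ℤ → ℝ) (lam : ℤ → Fin nx → ℝ)
        (x' : ℤ → Fin nx → ℝ) (u' : ℤ → ℝ) (lam' : ℤ → Fin nx → ℝ),
        LQKKT A Q b f c r 1 N xs ls x u lam →
        LQKKT A Q b f c r 1 N xs' ls' x' u' lam' →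
        ∀ i : ℤ, 1 ≤ i → i ≤ N →
          max ‖x i - x' i‖ ‖lam i - lam' i‖ ≤
            C * ρ ^ (i - 1).toNat * ‖xs - xs'‖ + C * ρ ^ (N - i).toNat * ‖ls - ls'‖ := by
  obtain ⟨C, hC, ρ, hρ, h⟩ := HomKKT.exists_decay hnx hQ hr hctrb
  refine ⟨C, hC, ρ, hρ, fun N hN xs ls xs' ls' x u lam x' u' lam' hx hx' i hi hiN => ?_⟩
  have key := h _ _ _ _ (hx.homKKT_sub hx') (i - 1).toNat (by omega)
  have e1 : (((i - 1).toNat : ℕ) : ℤ) + 1 = i := by omega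
  have e2 : (((N - 1).toNat : ℕ) : ℤ) + 1 = N := by omega
  have e3 : (N - 1).toNat - (i - 1).toNat = (N - i).toNat := by omega
  rw [e1, e2, e3, Nat.cast_zero, zero_add, hx.1, hx'.1, hx.2.1, hx'.2.1] at key
  exact key
end

section
/- (Demko-type decay bound.) Let Γ be a real symmetric positive definite n×n matrix, let 0 < λ_min ≤ λ_max be such that every eigenvalue of Γ lies in the interval [λ_min, λ_max], and let B ≥ 1 be an integer such that Γ_{i,j} = 0 whenever |i − j| > B. Then for all i, j ∈ {1,…,n}: |(Γ^{-1})_{i,j}| ≤ (1/λ_min) · ((λ_max − λ_min)/(λ_max + λ_min))^{|i−j|/B}, where the right-hand side uses the real power with exponent |i−j|/B. -/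
open Matrix

/-- An entry of an orthogonal conjugate of a diagonal matrix is bounded by any uniform bound on the
diagonal. -/
lemma abs_unitary_conj_diagonal_apply_le {m : Type*} [Fintype m] [DecidableEq m]
    (U : unitaryGroup m ℝ) (f : m → ℝ) (c : ℝ) (hf : ∀ k, |f k| ≤ c) (i j : m) :
    |((U : Matrix m m ℝ) * diagonal f * star (U : Matrix m m ℝ)) i j| ≤ c := by
  have row (i : m) : ∑ k, (U : Matrix m m ℝ) i k ^ 2 = 1 := by
    have h := congrFun (congrFun (mem_unitaryGroup_iff.mp U.2) i) i
    simpa [Matrix.mul_apply, star_apply, sq] using h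
  have hc : 0 ≤ c := (abs_nonneg _).trans (hf i)
  rw [Matrix.mul_apply]
  simp only [mul_diagonal, star_apply, star_trivial]
  calc |∑ k, (U : Matrix m m ℝ) i k * f k * (U : Matrix m m ℝ) j k|
      ≤ ∑ k, c * (((U : Matrix m m ℝ) i k ^ 2 + (U : Matrix m m ℝ) j k ^ 2) / 2) := by
        refine (Finset.abs_sum_le_sum_abs _ _).trans (Finset.sum_le_sum fun k _ => ?_)
        rw [mul_right_comm, abs_mul, mul_comm]
        refine mul_le_mul (hf k) ?_ (abs_nonneg _) hc
        rw [abs_le]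
        constructor <;> nlinarith [sq_nonneg ((U : Matrix m m ℝ) i k + (U : Matrix m m ℝ) j k),
          sq_nonneg ((U : Matrix m m ℝ) i k - (U : Matrix m m ℝ) j k)]
    _ = c := by
        rw [← Finset.mul_sum, ← Finset.sum_div, Finset.sum_add_distrib, row, row]
        norm_num

/-- The `k`-th power of a matrix of bandwidth `B` has bandwidth `k * B`. -/
lemma pow_apply_eq_zero_of_banded {R : Type*} [Semiring R] {n : ℕ} {A : Matrix (Fin n) (Fin n) R}
    {B : ℕ} (hA : ∀ i j : Fin n, (B : ℤ) < |((i : ℕ) : ℤ) - ((j : ℕ) : ℤ)| → A i j = 0)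
    (k : ℕ) (i j : Fin n) (hij : (k : ℤ) * B < |((i : ℕ) : ℤ) - ((j : ℕ) : ℤ)|) :
    (A ^ k) i j = 0 := by
  induction k generalizing i j with
  | zero =>
    rw [pow_zero, one_apply_ne]
    rintro rfl
    simp at hij
  | succ k ih =>
    rw [pow_succ, Matrix.mul_apply]
    refine Finset.sum_eq_zero fun l _ => ?_
    by_cases hl : (k : ℤ) * B < |((i : ℕ) : ℤ) - ((l : ℕ) : ℤ)|
    · rw [ih i l hl, zero_mul]
    · rw [hA l j, mul_zero]
      have h := abs_sub_le ((i : ℕ) : ℤ) ((l : ℕ) : ℤ) ((j : ℕ) : ℤ)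
      push_cast at hij
      linarith

/-- Demko-type decay bound: the inverse of a banded symmetric positive
definite matrix has exponentially decaying off-diagonal entries, with rate governed by
the spectral bounds and the bandwidth. -/
theorem demko_decay_bound
    (n : ℕ) (Γ : Matrix (Fin n) (Fin n) ℝ) (hΓ : Γ.PosDef)
    (lmin lmax : ℝ) (hlmin : 0 < lmin) (hle : lmin ≤ lmax)
    (hspec : ∀ μ ∈ spectrum ℝ Γ, lmin ≤ μ ∧ μ ≤ lmax)
    (B : ℕ) (hB : 1 ≤ B)
    (hband : ∀ i j : Fin n, (B : ℤ) < |((i : ℕ) : ℤ) - ((j : ℕ) : ℤ)| → Γ i j = 0) :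
    ∀ i j : Fin n,
      |Γ⁻¹ i j| ≤ (1 / lmin) *
        ((lmax - lmin) / (lmax + lmin)) ^
          (((((i : ℕ) : ℤ) - ((j : ℕ) : ℤ)).natAbs : ℝ) / (B : ℝ)) := by
  intro i j
  have hsum : 0 < lmin + lmax := by linarith
  set d : ℕ := (((i : ℕ) : ℤ) - ((j : ℕ) : ℤ)).natAbs with hd
  set ρ : ℝ := (lmax - lmin) / (lmax + lmin) with hρ
  set α : ℝ := 2 / (lmin + lmax) with hα
  set K : ℕ := ⌈(d : ℝ) / (B : ℝ)⌉₊ with hK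
  have hB0 : (0 : ℝ) < B := by exact_mod_cast hB
  have hρ0 : 0 ≤ ρ := div_nonneg (by linarith) (by linarith)
  have hρ1 : ρ ≤ 1 := (div_le_one (by linarith)).2 (by linarith)
  set R : Matrix (Fin n) (Fin n) ℝ := 1 - α • Γ with hR
  have hRband (a b : Fin n) (hab : (B : ℤ) < |((a : ℕ) : ℤ) - ((b : ℕ) : ℤ)|) : R a b = 0 := by
    have hne : a ≠ b := by
      rintro rfl
      simp at hab
      omega
    simp [hR, hband a b hab, one_apply_ne hne]
  have hdet : IsUnit Γ.det := hΓ.det_pos.ne'.isUnit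
  have hinv : Γ⁻¹ = α • ∑ k ∈ Finset.range K, R ^ k + R ^ K * Γ⁻¹ := by
    have h := geom_sum_mul_neg R K
    have h1 : 1 - R = α • Γ := by simp [hR]
    rw [h1] at h
    have h2 := congrArg (· * Γ⁻¹) h
    simp only [mul_smul_comm, smul_mul_assoc, mul_nonsing_inv_cancel_right _ _ hdet, sub_mul,
      one_mul] at h2
    rw [h2, sub_add_cancel]
  have hpow (k : ℕ) (hk : k ∈ Finset.range K) : (R ^ k) i j = 0 := by
    refine pow_apply_eq_zero_of_banded hRband k i j ?_
    rw [Finset.mem_range, hK, Nat.lt_ceil, lt_div_iff₀ hB0] at hk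
    rw [Int.abs_eq_natAbs, ← hd]
    exact_mod_cast hk
  have hentry : Γ⁻¹ i j = (R ^ K * Γ⁻¹) i j := by
    conv_lhs => rw [hinv]
    simp [Matrix.sum_apply, Finset.sum_eq_zero hpow]
  have hH := hΓ.isHermitian
  set μ := hH.eigenvalues with hμ
  have hμspec (k : Fin n) : lmin ≤ μ k ∧ μ k ≤ lmax :=
    hspec _ (hH.eigenvalues_mem_spectrum_real k)
  set φ := Unitary.conjStarAlgAut ℝ (Matrix (Fin n) (Fin n) ℝ) hH.eigenvectorUnitary with hφ
  have hΓφ : Γ = φ (diagonal μ) := hH.spectral_theorem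
  have hΓinv : Γ⁻¹ = φ (diagonal fun k => (μ k)⁻¹) := by
    refine inv_eq_right_inv ?_
    rw [hΓφ, ← map_mul, diagonal_mul_diagonal]
    have h (k : Fin n) : μ k * (μ k)⁻¹ = 1 :=
      mul_inv_cancel₀ (hlmin.trans_le (hμspec k).1).ne'
    simp [h]
  have hRφ : R = φ (diagonal fun k => 1 - α * μ k) := by
    have h : (diagonal fun k => 1 - α * μ k) = 1 - α • diagonal μ := by
      rw [← diagonal_one, ← diagonal_smul, diagonal_sub]
      rfl
    rw [h, map_sub, map_one, map_smul, ← hΓφ]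
  have hprod : R ^ K * Γ⁻¹ = φ (diagonal fun k => (1 - α * μ k) ^ K * (μ k)⁻¹) := by
    rw [hΓinv, hRφ, ← map_pow, ← map_mul, diagonal_pow, diagonal_mul_diagonal]
    rfl
  have hfilter (k : Fin n) : |(1 - α * μ k) ^ K * (μ k)⁻¹| ≤ ρ ^ K * lmin⁻¹ := by
    obtain ⟨h1, h2⟩ := hμspec k
    have hμ0 : 0 < μ k := hlmin.trans_le h1
    rw [abs_mul, abs_pow, abs_of_pos (inv_pos.2 hμ0)]
    have h3 : |1 - α * μ k| ≤ ρ := by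
      have h4 : 1 - α * μ k = (lmin + lmax - 2 * μ k) / (lmax + lmin) := by
        rw [hα, add_comm lmax lmin]
        field_simp
      rw [h4, abs_div, abs_of_pos (by linarith : 0 < lmax + lmin)]
      refine div_le_div_of_nonneg_right (abs_le.2 ⟨?_, ?_⟩) (by linarith) <;> linarith
    gcongr
  calc |Γ⁻¹ i j| ≤ ρ ^ K * lmin⁻¹ := by
        rw [hentry, hprod, hφ, Unitary.conjStarAlgAut_apply]
        exact abs_unitary_conj_diagonal_apply_le _ _ _ hfilter i j
    _ = 1 / lmin * ρ ^ (K : ℝ) := by rw [Real.rpow_natCast, one_div, mul_comm]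
    _ ≤ 1 / lmin * ρ ^ ((d : ℝ) / B) := by
        refine mul_le_mul_of_nonneg_left ?_ (by positivity)
        exact Real.rpow_le_rpow_of_exponent_ge' hρ0 hρ1 (by positivity) (Nat.le_ceil _)
end

section
/- (Uniform eigenvalue bounds for the reduced Hessian.) There exist real numbers λ_1, λ_2 > 0 depending only on n_x, A, b, Q, r (and not on N) such that for every integer N ≥ 2, every eigenvalue λ of the symmetric (N−1)×(N−1) matrix ZᵀHZ satisfies λ_1 ≤ λ ≤ λ_2. In particular, one may take λ_1 to be the smallest eigenvalue of Ĥ := Ẑᵀ diag(Q, r) Ẑ, where Ẑ is the (n_x+1)×(n_x+1) matrix whose j-th column, for 1 ≤ j ≤ n_x, is (x̄_{n_x+1−j}, ū_{n_x+1−j}) ∈ ℝ^{n_x+1} and whose last column is (0,…,0,1), and diag(Q, r) is block diagonal with blocks Q (n_x×n_x) and r (1×1). -/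
open Matrix

/-- The input entries of the `j`-th column of `Z` (0-based): `ū_{i−j}` for
`j ≤ i ≤ j + n_x`, and `0` otherwise. -/
def colU (ub : ℕ → ℝ) (nx j : ℕ) : ℕ → ℝ :=
  fun i => if j ≤ i ∧ i ≤ j + nx then ub (i - j) else 0

/-- The state trajectory generated from the zero initial state by the input
sequence `u` through the dynamics `x⁺ = Ax + bu`. -/
def traj {nx : ℕ} (A : Matrix (Fin nx) (Fin nx) ℝ) (b : Fin nx → ℝ) (u : ℕ → ℝ) :
    ℕ → Fin nx → ℝ
  | 0 => 0
  | i + 1 => A *ᵥ traj A b u i + u i • b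

/-- The null-space basis matrix `Z` (0-based indexing of times `0,…,N−1` for states and
`0,…,N−2` for inputs; the stacked-vector index type is `(Fin N × Fin nx) ⊕ Fin (N−1)`). -/
def Zmat (N nx : ℕ) (A : Matrix (Fin nx) (Fin nx) ℝ) (b : Fin nx → ℝ) (ub : ℕ → ℝ) :
    Matrix ((Fin N × Fin nx) ⊕ Fin (N - 1)) (Fin (N - 1)) ℝ :=
  fun p j =>
    match p with
    | Sum.inl (i, a) => traj A b (colU ub nx (j : ℕ)) (i : ℕ) a
    | Sum.inr i => colU ub nx (j : ℕ) (i : ℕ)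

/-- The block-diagonal Hessian `H = diag(Q, r, …, Q, r, 0)`. -/
def Hmat (N nx : ℕ) (Q : Matrix (Fin nx) (Fin nx) ℝ) (r : ℝ) :
    Matrix ((Fin N × Fin nx) ⊕ Fin (N - 1)) ((Fin N × Fin nx) ⊕ Fin (N - 1)) ℝ :=
  fun p q =>
    match p, q with
    | Sum.inl (i, a), Sum.inl (i', a') =>
        if i = i' ∧ (i : ℕ) + 1 < N then Q a a' else 0
    | Sum.inr j, Sum.inr j' => if j = j' then r else 0
    | _, _ => 0

/-- The matrix `Ẑ`: its `j`-th column (0-based, for `j < n_x`) is `(x̄_{n_x−j}, ū_{n_x−j})`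
and its last column is `(0,…,0,1)`. -/
def Zhat (nx : ℕ) (xb : ℕ → Fin nx → ℝ) (ub : ℕ → ℝ) :
    Matrix (Fin (nx + 1)) (Fin (nx + 1)) ℝ :=
  fun p j =>
    if hj : (j : ℕ) < nx then
      if hp : (p : ℕ) < nx then xb (nx - j) ⟨p, hp⟩ else ub (nx - j)
    else
      if (p : ℕ) < nx then 0 else 1

/-- The block-diagonal matrix `diag(Q, r)` of size `(n_x+1)×(n_x+1)`. -/
def diagQr (nx : ℕ) (Q : Matrix (Fin nx) (Fin nx) ℝ) (r : ℝ) :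
    Matrix (Fin (nx + 1)) (Fin (nx + 1)) ℝ :=
  fun p q =>
    if hp : (p : ℕ) < nx then
      if hq : (q : ℕ) < nx then Q ⟨p, hp⟩ ⟨q, hq⟩ else 0
    else
      if (q : ℕ) < nx then 0 else r

lemma traj_colU {nx : ℕ} {A : Matrix (Fin nx) (Fin nx) ℝ} {b : Fin nx → ℝ}
    {xb : ℕ → Fin nx → ℝ} {ub : ℕ → ℝ} (hxb0 : xb 0 = 0)
    (hrec : ∀ i ≤ nx, xb (i + 1) = A *ᵥ xb i + ub i • b) (hend : xb (nx + 1) = 0) (j i : ℕ) :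
    traj A b (colU ub nx j) i = if j ≤ i ∧ i ≤ j + nx then xb (i - j) else 0 := by
  induction i with
  | zero =>
    rw [traj, Nat.zero_sub, hxb0, ite_self]
  | succ i ih =>
    rw [traj, ih, colU]
    by_cases h : j ≤ i ∧ i ≤ j + nx
    · rw [if_pos h, if_pos h, ← hrec _ (by omega), ← Nat.sub_add_comm h.1]
      split_ifs with h'
      · rfl
      · rw [show i + 1 - j = nx + 1 by omega, hend]
    · rw [if_neg h, if_neg h]
      split_ifs with h'
      · rw [show i + 1 - j = 0 by omega, hxb0]; simp
      · simp

/-- The sliding window `(w_{i-n}, …, w_i)` of a vector `w`, extended by zero. -/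
def window {M : ℕ} (n : ℕ) (w : Fin M → ℝ) (i : ℕ) (p : Fin (n + 1)) : ℝ :=
  ∑ j : Fin M, if (j : ℕ) + n = i + p then w j else 0

lemma sum_mul_window {M : ℕ} (n : ℕ) (w : Fin M → ℝ) (i : ℕ) (f : ℕ → ℝ) :
    ∑ p : Fin (n + 1), f (n - p) * window n w i p =
      ∑ j : Fin M, (if (j : ℕ) ≤ i ∧ i ≤ j + n then f (i - j) else 0) * w j := by
  simp only [window, Finset.mul_sum]
  rw [Finset.sum_comm]
  refine Finset.sum_congr rfl fun j _ => ?_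
  split_ifs with h
  · rw [Finset.sum_eq_single (⟨j + n - i, by omega⟩ : Fin (n + 1))]
    · rw [if_pos (by simp only; omega)]
      congr 2
      simp only; omega
    · intro p _ hp
      rw [if_neg, mul_zero]
      intro h'
      exact hp (Fin.ext (by simp only; omega))
    · simp
  · rw [zero_mul]
    refine Finset.sum_eq_zero fun p _ => ?_
    rw [if_neg (by omega), mul_zero]

lemma window_last {M : ℕ} (n : ℕ) (w : Fin M → ℝ) (i : Fin M) :
    window n w i (Fin.last n) = w i := by
  simp [window, Fin.val_inj]

lemma window_sq {M : ℕ} (n : ℕ) (w : Fin M → ℝ) (i : ℕ) (p : Fin (n + 1)) :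
    window n w i p ^ 2 = ∑ j : Fin M, if (j : ℕ) + n = i + p then w j ^ 2 else 0 := by
  rw [window]
  by_cases h : ∃ j : Fin M, (j : ℕ) + n = i + p
  · obtain ⟨j, hj⟩ := h
    have hne : ∀ k : Fin M, k ≠ j → ¬ (k : ℕ) + n = i + p := fun k hk h' =>
      hk (Fin.ext (by omega))
    rw [Finset.sum_eq_single j, Finset.sum_eq_single j, if_pos hj, if_pos hj] <;>
      simp +contextual [hne]
  · push Not at h
    simp [h]

lemma dotProduct_self_le_sum_window {M : ℕ} (n : ℕ) (w : Fin M → ℝ) :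
    w ⬝ᵥ w ≤ ∑ i : Fin M, window n w i ⬝ᵥ window n w i := by
  refine Finset.sum_le_sum fun i _ => ?_
  rw [← window_last n w i]
  exact Finset.single_le_sum (f := fun p => window n w i p * window n w i p)
    (fun p _ => mul_self_nonneg _) (Finset.mem_univ (Fin.last n))

lemma sum_window_le {M : ℕ} (n : ℕ) (w : Fin M → ℝ) :
    ∑ i : Fin M, window n w i ⬝ᵥ window n w i ≤ (n + 1) * (w ⬝ᵥ w) := by
  have key : ∀ p : Fin (n + 1), ∑ i : Fin M, window n w i p ^ 2 ≤ w ⬝ᵥ w := by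
    intro p
    simp only [window_sq]
    rw [Finset.sum_comm]
    refine Finset.sum_le_sum fun j _ => ?_
    rw [← sq]
    by_cases h : ∃ i : Fin M, (j : ℕ) + n = i + p
    · obtain ⟨i, hi⟩ := h
      rw [Finset.sum_eq_single i, if_pos hi]
      · intro k _ hk
        exact if_neg fun h' => hk (Fin.ext (by omega))
      · simp
    · push Not at h
      simpa [h] using sq_nonneg (w j)
  simp only [dotProduct, ← sq] at key ⊢
  rw [Finset.sum_comm]
  simpa using Finset.sum_le_sum fun p (_ : p ∈ Finset.univ) => key p

lemma dotProduct_Hmat_mulVec (M nx : ℕ) (Q : Matrix (Fin nx) (Fin nx) ℝ) (r : ℝ)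
    (y : (Fin (M + 1) × Fin nx) ⊕ Fin (M + 1 - 1) → ℝ) :
    y ⬝ᵥ (Hmat (M + 1) nx Q r *ᵥ y) =
      ∑ i : Fin M, ((fun a => y (.inl (i.castSucc, a))) ⬝ᵥ
        (Q *ᵥ fun a => y (.inl (i.castSucc, a))) + r * y (.inr i) ^ 2) := by
  have h1 : ∀ i a, (Hmat (M + 1) nx Q r *ᵥ y) (.inl (Fin.castSucc i, a)) =
      (Q *ᵥ fun a => y (.inl (i.castSucc, a))) a := by
    intro i a
    simp only [mulVec, dotProduct, Fintype.sum_sum_type, Fintype.sum_prod_type, Hmat]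
    rw [Finset.sum_eq_single i.castSucc]
    · simp
    · intro k _ hk
      simp [hk.symm]
    · simp
  have h2 : ∀ a, (Hmat (M + 1) nx Q r *ᵥ y) (.inl (Fin.last M, a)) = 0 := by
    intro a
    simp [mulVec, dotProduct, Fintype.sum_sum_type, Hmat]
  have h3 : ∀ i, (Hmat (M + 1) nx Q r *ᵥ y) (.inr i) = r * y (.inr i) := by
    intro i
    simp [mulVec, dotProduct, Fintype.sum_sum_type, Hmat]
  rw [Finset.sum_add_distrib]
  simp only [dotProduct, Fintype.sum_sum_type, Fintype.sum_prod_type, Fin.sum_univ_castSucc (n := M),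
    h1, h2, h3, mul_zero, Finset.sum_const_zero, add_zero]
  congr 1
  exact Finset.sum_congr rfl fun i _ => by ring

lemma dotProduct_diagQr_mulVec (nx : ℕ) (Q : Matrix (Fin nx) (Fin nx) ℝ) (r : ℝ)
    (y : Fin (nx + 1) → ℝ) :
    y ⬝ᵥ (diagQr nx Q r *ᵥ y) =
      (fun a => y (Fin.castSucc a)) ⬝ᵥ (Q *ᵥ fun a => y (Fin.castSucc a)) +
        r * y (Fin.last nx) ^ 2 := by
  simp [dotProduct, mulVec, Fin.sum_univ_castSucc, diagQr]
  ring

lemma dotProduct_transpose_mul_mul_mulVec {m n : Type*} [Fintype m] [Fintype n]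
    (Z : Matrix m n ℝ) (H : Matrix m m ℝ) (w : n → ℝ) :
    w ⬝ᵥ ((Zᵀ * H * Z) *ᵥ w) = (Z *ᵥ w) ⬝ᵥ (H *ᵥ (Z *ᵥ w)) := by
  rw [← mulVec_mulVec, ← mulVec_mulVec, dotProduct_mulVec, vecMul_transpose]

lemma Zhat_mulVec_castSucc (nx : ℕ) {xb : ℕ → Fin nx → ℝ} {ub : ℕ → ℝ} (hxb0 : xb 0 = 0)
    (v : Fin (nx + 1) → ℝ) (a : Fin nx) :
    (Zhat nx xb ub *ᵥ v) a.castSucc = ∑ p : Fin (nx + 1), xb (nx - p) a * v p := by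
  simp [mulVec, dotProduct, Fin.sum_univ_castSucc, Zhat, hxb0]

lemma Zhat_mulVec_last (nx : ℕ) {xb : ℕ → Fin nx → ℝ} {ub : ℕ → ℝ} (hub0 : ub 0 = 1)
    (v : Fin (nx + 1) → ℝ) :
    (Zhat nx xb ub *ᵥ v) (Fin.last nx) = ∑ p : Fin (nx + 1), ub (nx - p) * v p := by
  simp [mulVec, dotProduct, Fin.sum_univ_castSucc, Zhat, hub0]

/-- The reduced Hessian is a sum of copies of `Ĥ` acting on sliding windows. -/
lemma dotProduct_reducedHessian_mulVec (M nx : ℕ)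
    {A : Matrix (Fin nx) (Fin nx) ℝ} {b : Fin nx → ℝ}
    (Q : Matrix (Fin nx) (Fin nx) ℝ) (r : ℝ)
    {xb : ℕ → Fin nx → ℝ} {ub : ℕ → ℝ} (hxb0 : xb 0 = 0) (hub0 : ub 0 = 1)
    (hrec : ∀ i ≤ nx, xb (i + 1) = A *ᵥ xb i + ub i • b) (hend : xb (nx + 1) = 0)
    (w : Fin M → ℝ) :
    w ⬝ᵥ (((Zmat (M + 1) nx A b ub)ᵀ * Hmat (M + 1) nx Q r * Zmat (M + 1) nx A b ub) *ᵥ w) =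
      ∑ i : Fin M, window nx w i ⬝ᵥ
        (((Zhat nx xb ub)ᵀ * diagQr nx Q r * Zhat nx xb ub) *ᵥ window nx w i) := by
  refine (dotProduct_transpose_mul_mul_mulVec (Zmat (M + 1) nx A b ub) _ w).trans ?_
  rw [dotProduct_Hmat_mulVec]
  refine Finset.sum_congr rfl fun i _ => ?_
  rw [dotProduct_transpose_mul_mul_mulVec, dotProduct_diagQr_mulVec]
  have hx : ∀ a, (Zmat (M + 1) nx A b ub *ᵥ w) (.inl (i.castSucc, a)) =
      (Zhat nx xb ub *ᵥ window nx w i) a.castSucc := by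
    intro a
    rw [Zhat_mulVec_castSucc nx hxb0, sum_mul_window nx w i fun k => xb k a, mulVec, dotProduct]
    refine Finset.sum_congr rfl fun j _ => ?_
    simp only [Zmat, traj_colU hxb0 hrec hend, Fin.val_castSucc]
    congr 1
    split_ifs <;> rfl
  have hu : (Zmat (M + 1) nx A b ub *ᵥ w) (.inr i) =
      (Zhat nx xb ub *ᵥ window nx w i) (Fin.last nx) := by
    rw [Zhat_mulVec_last nx hub0, sum_mul_window nx w i ub]
    rfl
  simp only [hx]
  rw [hu]

lemma exists_mulVec_eq_smul_of_mem_spectrum {n : Type*} [Fintype n] [DecidableEq n]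
    {M : Matrix n n ℝ} {μ : ℝ} (h : μ ∈ spectrum ℝ M) : ∃ v ≠ 0, M *ᵥ v = μ • v := by
  rw [← Matrix.spectrum_toLin', ← Module.End.hasEigenvalue_iff_mem_spectrum] at h
  obtain ⟨v, hv⟩ := h.exists_hasEigenvector
  exact ⟨v, hv.2, by simpa using hv.apply_eq_smul⟩

namespace Matrix.IsHermitian

variable {n : Type*} [Fintype n] [DecidableEq n] {M : Matrix n n ℝ}

lemma exists_isLeast_spectrum [Nonempty n] (hM : M.IsHermitian) :
    ∃ c, IsLeast (spectrum ℝ M) c := by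
  rw [hM.spectrum_real_eq_range_eigenvalues]
  exact ⟨_, (Set.finite_range _).isCompact.isLeast_sInf (Set.range_nonempty _)⟩

lemma exists_isGreatest_spectrum [Nonempty n] (hM : M.IsHermitian) :
    ∃ c, IsGreatest (spectrum ℝ M) c := by
  rw [hM.spectrum_real_eq_range_eigenvalues]
  exact ⟨_, (Set.finite_range _).isCompact.isGreatest_sSup (Set.range_nonempty _)⟩

lemma mul_dotProduct_self_le (hM : M.IsHermitian) {c : ℝ} (hc : c ∈ lowerBounds (spectrum ℝ M))
    (v : n → ℝ) : c * (v ⬝ᵥ v) ≤ v ⬝ᵥ (M *ᵥ v) := by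
  have hpsd : (M - algebraMap ℝ _ c).PosSemidef := by
    refine posSemidef_iff_isHermitian_and_spectrum_nonneg.2 ⟨hM.sub ?_, ?_⟩
    · rw [algebraMap_eq_diagonal]
      exact isHermitian_diagonal _
    · rw [← spectrum.sub_singleton_eq]
      rintro _ ⟨x, hx, _, rfl, rfl⟩
      exact sub_nonneg.2 (hc hx)
  have h := hpsd.dotProduct_mulVec_nonneg v
  rw [Algebra.algebraMap_eq_smul_one, sub_mulVec, smul_mulVec, one_mulVec, dotProduct_sub,
    dotProduct_smul, star_trivial, smul_eq_mul] at h
  linarith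

lemma dotProduct_mulVec_le (hM : M.IsHermitian) {c : ℝ} (hc : c ∈ upperBounds (spectrum ℝ M))
    (v : n → ℝ) : v ⬝ᵥ (M *ᵥ v) ≤ c * (v ⬝ᵥ v) := by
  have h := hM.neg.mul_dotProduct_self_le (c := -c) (by
    rw [← spectrum.neg_eq]
    intro x hx
    linarith [hc hx]) v
  rw [neg_mulVec, dotProduct_neg] at h
  linarith

end Matrix.IsHermitian

lemma isHermitian_transpose_mul_mul {m n : Type*} [Fintype m] (Z : Matrix m n ℝ)
    {H : Matrix m m ℝ} (hH : H.IsHermitian) : (Zᵀ * H * Z).IsHermitian := by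
  simpa using isHermitian_conjTranspose_mul_mul Z hH

lemma isHermitian_diagQr {nx : ℕ} {Q : Matrix (Fin nx) (Fin nx) ℝ} (r : ℝ) (hQ : Q.IsHermitian) :
    (diagQr nx Q r).IsHermitian := by
  ext p q
  simp only [conjTranspose_apply, diagQr, star_trivial]
  split_ifs
  · simpa using hQ.apply _ _
  all_goals rfl

lemma dotProduct_diagQr_mulVec_pos {nx : ℕ} {Q : Matrix (Fin nx) (Fin nx) ℝ} (hQ : Q.PosDef)
    {r : ℝ} (hr : 0 < r) {y : Fin (nx + 1) → ℝ} (hy : y ≠ 0) :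
    0 < y ⬝ᵥ (diagQr nx Q r *ᵥ y) := by
  rw [dotProduct_diagQr_mulVec]
  by_cases h : (fun a => y (Fin.castSucc a)) = 0
  · have hlast : y (Fin.last nx) ≠ 0 := fun h' =>
      hy (funext (Fin.lastCases h' fun a => congrFun h a))
    rw [h, zero_dotProduct, zero_add]
    positivity
  · have := hQ.dotProduct_mulVec_pos h
    rw [star_trivial] at this
    positivity

section Controllability

variable {nx : ℕ} {A : Matrix (Fin nx) (Fin nx) ℝ} {b : Fin nx → ℝ}
  {xb : ℕ → Fin nx → ℝ} {ub : ℕ → ℝ}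

lemma pow_mulVec_mem_span (hxb0 : xb 0 = 0) (hub0 : ub 0 = 1)
    (hrec : ∀ i ≤ nx, xb (i + 1) = A *ᵥ xb i + ub i • b) (k : ℕ) (hk : k ≤ nx) :
    (A ^ k) *ᵥ b ∈ Submodule.span ℝ ((fun i => xb (i + 1)) '' Set.Iic k) := by
  have hb : b = xb 1 := by simp [hrec 0 (Nat.zero_le _), hxb0, hub0]
  induction k with
  | zero =>
    rw [pow_zero, one_mulVec]
    exact Submodule.subset_span ⟨0, by simp, hb.symm⟩
  | succ k ih =>
    rw [pow_succ', ← mulVec_mulVec]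
    have hmap := Submodule.mem_map_of_mem (f := A.mulVecLin) (ih (by omega))
    rw [Submodule.map_span] at hmap
    refine Submodule.span_le.2 ?_ hmap
    rintro _ ⟨_, ⟨i, hi, rfl⟩, rfl⟩
    rw [Set.mem_Iic] at hi
    have hA : A *ᵥ xb (i + 1) = xb (i + 1 + 1) - ub (i + 1) • b := by
      rw [hrec (i + 1) (by omega), add_sub_cancel_right]
    rw [SetLike.mem_coe, mulVecLin_apply, hA]
    refine Submodule.sub_mem _ (Submodule.subset_span ⟨i + 1, by simpa using hi, rfl⟩)
      (Submodule.smul_mem _ _ (Submodule.subset_span ⟨0, by simp, hb.symm⟩))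

lemma linearIndependent_deadbeat_states (hctrb : IsUnit (ctrbMat A b)) (hxb0 : xb 0 = 0)
    (hub0 : ub 0 = 1) (hrec : ∀ i ≤ nx, xb (i + 1) = A *ᵥ xb i + ub i • b) :
    LinearIndependent ℝ fun i : Fin nx => xb (i + 1) := by
  refine linearIndependent_of_top_le_span_of_card_eq_finrank ?_ (by simp)
  have hcols : LinearIndependent ℝ (ctrbMat A b).col := linearIndependent_cols_iff_isUnit.2 hctrb
  rw [← hcols.span_eq_top_of_card_eq_finrank' (by simp), Submodule.span_le]
  rintro _ ⟨k, rfl⟩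
  refine Submodule.span_mono ?_ (pow_mulVec_mem_span hxb0 hub0 hrec k k.2.le)
  rintro _ ⟨i, hi, rfl⟩
  exact ⟨⟨i, lt_of_le_of_lt hi k.2⟩, rfl⟩

lemma Zhat_mulVec_ne_zero (hctrb : IsUnit (ctrbMat A b)) (hxb0 : xb 0 = 0)
    (hub0 : ub 0 = 1) (hrec : ∀ i ≤ nx, xb (i + 1) = A *ᵥ xb i + ub i • b)
    {v : Fin (nx + 1) → ℝ} (hv : v ≠ 0) : Zhat nx xb ub *ᵥ v ≠ 0 := by
  intro h
  have hstate : ∑ p : Fin nx, v p.castSucc • xb (nx - p) = 0 := by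
    ext a
    have := congrFun h a.castSucc
    rw [Zhat_mulVec_castSucc nx hxb0] at this
    simpa [Fin.sum_univ_castSucc, hxb0, mul_comm] using this
  have hinit : ∀ p : Fin nx, v p.castSucc = 0 := by
    have hli := (linearIndependent_deadbeat_states hctrb hxb0 hub0 hrec).comp Fin.rev
      Fin.rev_injective
    refine Fintype.linearIndependent_iff.1 hli _ (Eq.trans ?_ hstate)
    refine Finset.sum_congr rfl fun p _ => ?_
    rw [Function.comp_apply, Fin.val_rev, show nx - ((p : ℕ) + 1) + 1 = nx - p by omega]
  have hlast : v (Fin.last nx) = 0 := by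
    have := congrFun h (Fin.last nx)
    rw [Zhat_mulVec_last nx hub0] at this
    simpa [Fin.sum_univ_castSucc, hinit, hub0] using this
  exact hv (funext (Fin.lastCases hlast hinit))

end Controllability

/-- uniform eigenvalue bounds for the reduced Hessian: there are
`λ₁, λ₂ > 0` independent of `N` such that every eigenvalue of `ZᵀHZ` lies in `[λ₁, λ₂]`;
moreover one may take `λ₁` to be the smallest eigenvalue of `Ĥ = Ẑᵀ diag(Q,r) Ẑ`. -/
theorem reduced_hessian_uniform_eigenvalue_bounds
    (nx : ℕ) (hnx : 1 ≤ nx)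
    (A : Matrix (Fin nx) (Fin nx) ℝ) (b : Fin nx → ℝ) (hctrb : IsUnit (ctrbMat A b))
    (Q : Matrix (Fin nx) (Fin nx) ℝ) (hQ : Q.PosDef) (r : ℝ) (hr : 0 < r)
    (xb : ℕ → Fin nx → ℝ) (ub : ℕ → ℝ)
    (hxb0 : xb 0 = 0) (hub0 : ub 0 = 1)
    (hrec : ∀ i ≤ nx, xb (i + 1) = A *ᵥ xb i + ub i • b)
    (hend : xb (nx + 1) = 0) :
    ∃ lam1 lam2 : ℝ, 0 < lam1 ∧ 0 < lam2 ∧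
      IsLeast (spectrum ℝ ((Zhat nx xb ub)ᵀ * diagQr nx Q r * Zhat nx xb ub)) lam1 ∧
      ∀ N : ℕ, 2 ≤ N →
        ∀ μ ∈ spectrum ℝ
          ((Zmat N nx A b ub)ᵀ * Hmat N nx Q r * Zmat N nx A b ub),
          lam1 ≤ μ ∧ μ ≤ lam2 := by
  have hH := isHermitian_transpose_mul_mul (Zhat nx xb ub) (isHermitian_diagQr r hQ.isHermitian)
  obtain ⟨lam1, hleast⟩ := hH.exists_isLeast_spectrum
  obtain ⟨lam2, hgreatest⟩ := hH.exists_isGreatest_spectrum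
  have hpos : 0 < lam1 := by
    obtain ⟨v, hv0, hv⟩ := exists_mulVec_eq_smul_of_mem_spectrum hleast.1
    have hZv := Zhat_mulVec_ne_zero hctrb hxb0 hub0 hrec hv0
    have h := dotProduct_diagQr_mulVec_pos hQ hr hZv
    rw [← dotProduct_transpose_mul_mul_mulVec, hv, dotProduct_smul, smul_eq_mul] at h
    exact pos_of_mul_pos_left h (Finset.sum_nonneg fun i _ => mul_self_nonneg (v i))
  have hle : lam1 ≤ lam2 := hleast.2 hgreatest.1
  refine ⟨lam1, (nx + 1) * lam2, hpos, mul_pos (by positivity) (hpos.trans_le hle), hleast,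
    fun N hN μ hμ => ?_⟩
  obtain ⟨M, rfl⟩ : ∃ M, N = M + 1 := ⟨N - 1, by omega⟩
  obtain ⟨w, hw0, hw⟩ := exists_mulVec_eq_smul_of_mem_spectrum hμ
  have hquad := dotProduct_reducedHessian_mulVec M nx Q r hxb0 hub0 hrec hend w
  rw [show _ *ᵥ w = μ • w from hw, dotProduct_smul, smul_eq_mul] at hquad
  have hwpos : 0 < w ⬝ᵥ w := by simpa using dotProduct_star_self_pos_iff.2 hw0
  constructor
  · refine le_of_mul_le_mul_right ?_ hwpos
    calc lam1 * (w ⬝ᵥ w) ≤ lam1 * ∑ i : Fin M, window nx w i ⬝ᵥ window nx w i :=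
          mul_le_mul_of_nonneg_left (dotProduct_self_le_sum_window nx w) hpos.le
      _ ≤ μ * (w ⬝ᵥ w) := by
          rw [hquad, Finset.mul_sum]
          exact Finset.sum_le_sum fun i _ => hH.mul_dotProduct_self_le hleast.2 _
  · refine le_of_mul_le_mul_right ?_ hwpos
    calc μ * (w ⬝ᵥ w) ≤ lam2 * ∑ i : Fin M, window nx w i ⬝ᵥ window nx w i := by
          rw [hquad, Finset.mul_sum]
          exact Finset.sum_le_sum fun i _ => hH.dotProduct_mulVec_le hgreatest.2 _
      _ ≤ lam2 * ((nx + 1) * (w ⬝ᵥ w)) :=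
          mul_le_mul_of_nonneg_left (sum_window_le nx w) (hpos.le.trans hle)
      _ = (nx + 1) * lam2 * (w ⬝ᵥ w) := by ring
end

section
/- The vectors x̄_1, x̄_2, …, x̄_{n_x} are linearly independent in ℝ^{n_x}. -/
open Matrix

/-- the states `x̄_1, …, x̄_{n_x}` of the deadbeat trajectory are
linearly independent in `ℝ^{n_x}`. -/
theorem deadbeat_states_linearIndependent
    (nx : ℕ) (hnx : 1 ≤ nx)
    (A : Matrix (Fin nx) (Fin nx) ℝ) (b : Fin nx → ℝ) (hctrb : IsUnit (ctrbMat A b))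
    (xb : ℕ → Fin nx → ℝ) (ub : ℕ → ℝ)
    (hxb0 : xb 0 = 0) (hub0 : ub 0 = 1)
    (hrec : ∀ i ≤ nx, xb (i + 1) = A *ᵥ xb i + ub i • b)
    (hend : xb (nx + 1) = 0) :
    LinearIndependent ℝ (fun j : Fin nx => xb ((j : ℕ) + 1)) := by
  set S := Submodule.span ℝ (Set.range fun j : Fin nx => xb ((j : ℕ) + 1)) with hS
  have hmem (j : Fin nx) : xb ((j : ℕ) + 1) ∈ S := Submodule.subset_span ⟨j, rfl⟩
  have hb : b ∈ S := by
    have h := hmem ⟨0, hnx⟩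
    simpa [hrec 0 (Nat.zero_le nx), hxb0, hub0] using h
  have hinv : S ≤ S.comap A.mulVecLin := by
    rw [hS, Submodule.span_le, ← hS]
    rintro _ ⟨j, rfl⟩
    have hAx : A *ᵥ xb ((j : ℕ) + 1) = xb ((j : ℕ) + 1 + 1) - ub ((j : ℕ) + 1) • b := by
      rw [hrec _ j.isLt, add_sub_cancel_right]
    have hnext : xb ((j : ℕ) + 1 + 1) ∈ S := by
      rcases Nat.lt_or_eq_of_le (Nat.succ_le_of_lt j.isLt) with h | h
      · exact hmem ⟨_, h⟩
      · have h0 : xb ((j : ℕ) + 1 + 1) = 0 := (congrArg (fun n => xb (n + 1)) h).trans hend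
        rw [h0]
        exact S.zero_mem
    change A *ᵥ xb ((j : ℕ) + 1) ∈ S
    rw [hAx]
    exact S.sub_mem hnext (S.smul_mem _ hb)
  have hpow (k : ℕ) : (A ^ k) *ᵥ b ∈ S := by
    induction k with
    | zero => simpa using hb
    | succ k ih =>
      rw [pow_succ', ← Matrix.mulVec_mulVec]
      exact hinv ih
  refine linearIndependent_of_top_le_span_of_card_eq_finrank ?_ (by simp)
  intro v _
  obtain ⟨c, rfl⟩ := (Matrix.mulVec_surjective_iff_isUnit.mpr hctrb) v
  simp only [Matrix.mulVec_eq_sum, op_smul_eq_smul]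
  exact S.sum_mem fun j _ => S.smul_mem _ (hpow j)
end

section
/- (Null-space method for equality-constrained quadratic programs.) Let H be a real symmetric n×n matrix, G a real m×n matrix with full row rank, Z a real n×(n−m) matrix whose columns form a basis of the null space of G, and Y a real n×m matrix with GY = I_m. Assume ZᵀHZ is invertible. Then for every ζ ∈ ℝ^n and ξ ∈ ℝ^m, the KKT system Hw + Gᵀλ = ζ, Gw = ξ has exactly one solution (w, λ) ∈ ℝ^n × ℝ^m, and it is given by w = Z p + Y ξ with p = (ZᵀHZ)^{-1} Zᵀ(ζ − H Y ξ), and λ = Yᵀ(ζ − H w). -/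
open Matrix

/-- If `Y` is a right inverse of `G` and `Z` spans the null space of `G`, then a vector orthogonal
to the columns of `Z` is fixed by `GᵀYᵀ`. -/
theorem transpose_mulVec_transpose_mulVec_eq_self
    {R ι κ μ : Type*} [CommRing R] [Fintype ι] [Fintype κ] [Fintype μ] [DecidableEq κ]
    {G : Matrix κ ι R} {Z : Matrix ι μ R} {Y : Matrix ι κ R}
    (hspan : ∀ v : ι → R, G *ᵥ v = 0 → ∃ q : μ → R, v = Z *ᵥ q)
    (hGY : G * Y = 1) {r : ι → R} (hr : Zᵀ *ᵥ r = 0) :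
    Gᵀ *ᵥ (Yᵀ *ᵥ r) = r := by
  refine dotProduct_eq _ _ fun v => ?_
  obtain ⟨q, hq⟩ := hspan (v - Y *ᵥ (G *ᵥ v)) (by
    rw [mulVec_sub, mulVec_mulVec, hGY, one_mulVec, sub_self])
  have h : r ⬝ᵥ (v - Y *ᵥ (G *ᵥ v)) = 0 := by
    rw [hq, dotProduct_mulVec, ← mulVec_transpose, hr, zero_dotProduct]
  rw [dotProduct_sub, sub_eq_zero] at h
  rw [h, mulVec_transpose, mulVec_transpose, ← dotProduct_mulVec, ← dotProduct_mulVec]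

/-- null-space method for equality-constrained quadratic programs:
if `G` has full row rank, the columns of `Z` form a basis of the null space of `G`,
`GY = I`, and the reduced Hessian `ZᵀHZ` is invertible, then the KKT system
`Hw + Gᵀλ = ζ`, `Gw = ξ` has a unique solution, given by the null-space formulas. -/
theorem null_space_method
    (n m : ℕ)
    (H : Matrix (Fin n) (Fin n) ℝ) (hH : Hᵀ = H)
    (G : Matrix (Fin m) (Fin n) ℝ) (hG : G.rank = m)
    (Z : Matrix (Fin n) (Fin (n - m)) ℝ)
    (hGZ : G * Z = 0)
    (hZli : LinearIndependent ℝ (fun j : Fin (n - m) => Zᵀ j))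
    (hZspan : ∀ v : Fin n → ℝ, G *ᵥ v = 0 → ∃ pcoef : Fin (n - m) → ℝ, v = Z *ᵥ pcoef)
    (Y : Matrix (Fin n) (Fin m) ℝ) (hGY : G * Y = 1)
    (hinv : IsUnit (Zᵀ * H * Z)) :
    ∀ (ζ : Fin n → ℝ) (ξ : Fin m → ℝ),
      (∃! wl : (Fin n → ℝ) × (Fin m → ℝ),
        H *ᵥ wl.1 + Gᵀ *ᵥ wl.2 = ζ ∧ G *ᵥ wl.1 = ξ) ∧
      (∀ (w : Fin n → ℝ) (lam : Fin m → ℝ),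
        H *ᵥ w + Gᵀ *ᵥ lam = ζ → G *ᵥ w = ξ →
          w = Z *ᵥ ((Zᵀ * H * Z)⁻¹ *ᵥ (Zᵀ *ᵥ (ζ - H *ᵥ (Y *ᵥ ξ)))) + Y *ᵥ ξ ∧
          lam = Yᵀ *ᵥ (ζ - H *ᵥ w)) := by
  intro ζ ξ
  have hdet : IsUnit (Zᵀ * H * Z).det := (isUnit_iff_isUnit_det _).mp hinv
  have formulas : ∀ (w : Fin n → ℝ) (lam : Fin m → ℝ),
      H *ᵥ w + Gᵀ *ᵥ lam = ζ → G *ᵥ w = ξ →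
        w = Z *ᵥ ((Zᵀ * H * Z)⁻¹ *ᵥ (Zᵀ *ᵥ (ζ - H *ᵥ (Y *ᵥ ξ)))) + Y *ᵥ ξ ∧
        lam = Yᵀ *ᵥ (ζ - H *ᵥ w) := by
    intro w lam hζ hξ
    have hres : ζ - H *ᵥ w = Gᵀ *ᵥ lam := by rw [← hζ, add_sub_cancel_left]
    constructor
    · obtain ⟨p, hp⟩ := hZspan (w - Y *ᵥ ξ) (by
        rw [mulVec_sub, mulVec_mulVec, hGY, one_mulVec, hξ, sub_self])
      have hw : w = Z *ᵥ p + Y *ᵥ ξ := by rw [← hp, sub_add_cancel]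
      have hrhs : ζ - H *ᵥ (Y *ᵥ ξ) = H *ᵥ (Z *ᵥ p) + Gᵀ *ᵥ lam := by
        rw [← hres, hw, mulVec_add]
        abel
      have hred : Zᵀ *ᵥ (ζ - H *ᵥ (Y *ᵥ ξ)) = (Zᵀ * H * Z) *ᵥ p := by
        rw [hrhs, mulVec_add, mulVec_mulVec, mulVec_mulVec, mulVec_mulVec, ← transpose_mul, hGZ,
          transpose_zero, zero_mulVec, add_zero]
      rw [hred, mulVec_mulVec p, nonsing_inv_mul _ hdet, one_mulVec]
      exact hw
    · rw [hres, mulVec_mulVec, ← transpose_mul, hGY, transpose_one, one_mulVec]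
  refine ⟨?_, formulas⟩
  set p := (Zᵀ * H * Z)⁻¹ *ᵥ (Zᵀ *ᵥ (ζ - H *ᵥ (Y *ᵥ ξ))) with hp
  clear_value p
  have hred : (Zᵀ * H * Z) *ᵥ p = Zᵀ *ᵥ (ζ - H *ᵥ (Y *ᵥ ξ)) := by
    rw [hp, mulVec_mulVec, mul_nonsing_inv _ hdet, one_mulVec]
  have horth : Zᵀ *ᵥ (ζ - H *ᵥ (Z *ᵥ p + Y *ᵥ ξ)) = 0 := by
    rw [mulVec_add, add_comm, ← sub_sub, mulVec_sub, ← hred, mulVec_mulVec, mulVec_mulVec,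
      sub_self]
  refine ⟨(Z *ᵥ p + Y *ᵥ ξ, Yᵀ *ᵥ (ζ - H *ᵥ (Z *ᵥ p + Y *ᵥ ξ))), ⟨?_, ?_⟩, ?_⟩
  · dsimp only
    rw [transpose_mulVec_transpose_mulVec_eq_self hZspan hGY horth, add_sub_cancel]
  · dsimp only
    rw [mulVec_add, mulVec_mulVec, mulVec_mulVec, hGZ, hGY, zero_mulVec, one_mulVec, zero_add]
  · rintro ⟨w, lam⟩ ⟨hζ, hξ⟩
    obtain ⟨hw, hlam⟩ := formulas w lam hζ hξ
    rw [← hw, ← hlam]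
end

section
/- The matrix Z satisfies G Z = 0, Z has full column rank N−1, and the columns of Z span the null space of G; that is, the columns of Z form a basis of {w : Gw = 0} = {w = (x_1,u_1,…,x_{N−1},u_{N−1},x_N) : x_1 = 0 and x_{i+1} = A x_i + b u_i for 1 ≤ i ≤ N−1}, which therefore has dimension N−1. -/
open Matrix

/-- The constraint matrix `G`, representing
`w ↦ (x_1, x_2 − A x_1 − b u_1, …, x_N − A x_{N−1} − b u_{N−1})` (0-based time). -/
def Gmat (N nx : ℕ) (A : Matrix (Fin nx) (Fin nx) ℝ) (b : Fin nx → ℝ) :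
    Matrix (Fin N × Fin nx) ((Fin N × Fin nx) ⊕ Fin (N - 1)) ℝ :=
  fun p q =>
    match p, q with
    | (i, a), Sum.inl (i', a') =>
        if (i : ℕ) = (i' : ℕ) then (if a = a' then 1 else 0)
        else if (i : ℕ) = (i' : ℕ) + 1 then -A a a' else 0
    | (i, a), Sum.inr j => if (i : ℕ) = (j : ℕ) + 1 then -(b a) else 0

lemma Gmat_mulVec_zero {N nx : ℕ} (A : Matrix (Fin nx) (Fin nx) ℝ) (b : Fin nx → ℝ)
    (w : ((Fin N × Fin nx) ⊕ Fin (N - 1)) → ℝ) (h : 0 < N) (a : Fin nx) :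
    (Gmat N nx A b *ᵥ w) (⟨0, h⟩, a) = w (Sum.inl (⟨0, h⟩, a)) := by
  have entry : ∀ (i' : Fin N) (a' : Fin nx),
      Gmat N nx A b (⟨0, h⟩, a) (Sum.inl (i', a')) =
        if ⟨0, h⟩ = i' then (if a = a' then 1 else 0) else 0 := by
    intro i' a'
    simp [Gmat, Fin.ext_iff]
  have input_entry : ∀ j : Fin (N - 1), Gmat N nx A b (⟨0, h⟩, a) (Sum.inr j) = 0 := by
    simp [Gmat]
  simp [mulVec, dotProduct, Fintype.sum_sum_type, Fintype.sum_prod_type, entry, input_entry,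
    ite_mul]

lemma Gmat_mulVec_succ {N nx : ℕ} (A : Matrix (Fin nx) (Fin nx) ℝ) (b : Fin nx → ℝ)
    (w : ((Fin N × Fin nx) ⊕ Fin (N - 1)) → ℝ) (i : ℕ) (h : i + 1 < N) (a : Fin nx) :
    (Gmat N nx A b *ᵥ w) (⟨i + 1, h⟩, a) =
      w (Sum.inl (⟨i + 1, h⟩, a)) -
        ((A *ᵥ fun a' => w (Sum.inl (⟨i, by omega⟩, a'))) a +
          w (Sum.inr ⟨i, by omega⟩) * b a) := by
  have entry : ∀ (i' : Fin N) (a' : Fin nx),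
      Gmat N nx A b (⟨i + 1, h⟩, a) (Sum.inl (i', a')) =
        (if ⟨i + 1, h⟩ = i' then (if a = a' then 1 else 0) else 0) -
          if ⟨i, by omega⟩ = i' then A a a' else 0 := by
    intro i' a'
    simp only [Gmat, Fin.ext_iff]
    split_ifs <;> first | omega | simp
  have input_entry : ∀ j : Fin (N - 1), Gmat N nx A b (⟨i + 1, h⟩, a) (Sum.inr j) =
      if ⟨i, by omega⟩ = j then -(b a) else 0 := by
    intro j
    simp [Gmat, Fin.ext_iff]
  have sum_ite : ∀ (k : Fin N) (f : Fin N → Fin nx → ℝ),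
      ∑ i', ∑ a', (if k = i' then f i' a' else 0) = ∑ a', f k a' := by
    intro k f
    rw [Finset.sum_comm]
    simp
  simp only [mulVec, dotProduct, Fintype.sum_sum_type, Fintype.sum_prod_type, entry, input_entry,
    sub_mul, ite_mul, zero_mul, Finset.sum_sub_distrib, sum_ite]
  simp
  ring

lemma Gmat_mulVec_eq_zero_iff {N nx : ℕ} (A : Matrix (Fin nx) (Fin nx) ℝ) (b : Fin nx → ℝ)
    (hN : 0 < N) (w : ((Fin N × Fin nx) ⊕ Fin (N - 1)) → ℝ) :
    Gmat N nx A b *ᵥ w = 0 ↔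
      ((∀ a : Fin nx, w (Sum.inl (⟨0, hN⟩, a)) = 0) ∧
       (∀ i : ℕ, ∀ h : i + 1 < N, ∀ a : Fin nx,
          w (Sum.inl (⟨i + 1, h⟩, a)) =
            (A *ᵥ fun a' => w (Sum.inl (⟨i, by omega⟩, a'))) a +
              w (Sum.inr ⟨i, by omega⟩) * b a)) := by
  constructor
  · intro hw
    refine ⟨fun a => ?_, fun i h a => ?_⟩
    · rw [← Gmat_mulVec_zero A b w hN a, hw, Pi.zero_apply]
    · rw [← sub_eq_zero, ← Gmat_mulVec_succ A b w i h a, hw, Pi.zero_apply]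
  · rintro ⟨h0, hs⟩
    ext ⟨⟨i, hi⟩, a⟩
    cases i with
    | zero => rw [Gmat_mulVec_zero, h0, Pi.zero_apply]
    | succ i => rw [Gmat_mulVec_succ, hs, sub_self, Pi.zero_apply]

lemma Gmat_mul_Zmat {N nx : ℕ} (A : Matrix (Fin nx) (Fin nx) ℝ) (b : Fin nx → ℝ) (ub : ℕ → ℝ)
    (hN : 0 < N) : Gmat N nx A b * Zmat N nx A b ub = 0 := by
  have column : ∀ j, Gmat N nx A b *ᵥ (fun p => Zmat N nx A b ub p j) = 0 := by
    intro j
    rw [Gmat_mulVec_eq_zero_iff A b hN]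
    exact ⟨fun a => rfl, fun i h a => rfl⟩
  ext p j
  exact congrFun (column j) p

/-- A vector in the null space of `G` is determined by its inputs. -/
lemma eq_zero_of_Gmat_mulVec_eq_zero {N nx : ℕ} {A : Matrix (Fin nx) (Fin nx) ℝ}
    {b : Fin nx → ℝ} {w : ((Fin N × Fin nx) ⊕ Fin (N - 1)) → ℝ}
    (hw : Gmat N nx A b *ᵥ w = 0) (hu : ∀ j, w (Sum.inr j) = 0) : w = 0 := by
  have state : ∀ (i : ℕ) (h : i < N), (fun a => w (Sum.inl (⟨i, h⟩, a))) = 0 := by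
    intro i
    induction i with
    | zero =>
      intro h
      exact funext ((Gmat_mulVec_eq_zero_iff A b h w).1 hw).1
    | succ i ih =>
      intro h
      ext a
      have step := ((Gmat_mulVec_eq_zero_iff A b (by omega) w).1 hw).2 i h a
      rw [ih, hu] at step
      simpa using step
  ext (⟨⟨i, h⟩, a⟩ | j)
  · exact congrFun (state i h) a
  · exact hu j

/-- The rows of `Z` giving the inputs form a unit lower triangular matrix. -/
lemma isUnit_Zmat_submatrix_inr (N nx : ℕ) (A : Matrix (Fin nx) (Fin nx) ℝ) (b : Fin nx → ℝ)
    {ub : ℕ → ℝ} (hub0 : ub 0 = 1) : IsUnit ((Zmat N nx A b ub).submatrix Sum.inr id) := by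
  rw [isUnit_iff_isUnit_det, det_of_isLowerTriangular]
  · simp [Zmat, colU, hub0]
  · intro i j hij
    have hij' : (i : ℕ) < j := hij
    exact if_neg fun h => absurd h.1 hij'.not_ge

/-- `GZ = 0`, `Z` has full column rank `N−1`, and the columns of `Z`
span the null space of `G`, which is exactly the set of stacked vectors satisfying
`x_1 = 0` and the dynamics `x_{i+1} = A x_i + b u_i`, and which has dimension `N−1`. -/
theorem Zmat_basis_of_nullspace
    (nx : ℕ) (hnx : 1 ≤ nx)
    (A : Matrix (Fin nx) (Fin nx) ℝ) (b : Fin nx → ℝ) (hctrb : IsUnit (ctrbMat A b))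
    (xb : ℕ → Fin nx → ℝ) (ub : ℕ → ℝ)
    (hxb0 : xb 0 = 0) (hub0 : ub 0 = 1)
    (hrec : ∀ i ≤ nx, xb (i + 1) = A *ᵥ xb i + ub i • b)
    (hend : xb (nx + 1) = 0)
    (N : ℕ) (hN : 2 ≤ N) :
    Gmat N nx A b * Zmat N nx A b ub = 0 ∧
    LinearIndependent ℝ (fun j : Fin (N - 1) => (Zmat N nx A b ub)ᵀ j) ∧
    (∀ w : ((Fin N × Fin nx) ⊕ Fin (N - 1)) → ℝ,
      Gmat N nx A b *ᵥ w = 0 ↔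
        ((∀ a : Fin nx, w (Sum.inl (⟨0, by omega⟩, a)) = 0) ∧
         (∀ i : ℕ, ∀ h : i + 1 < N, ∀ a : Fin nx,
            w (Sum.inl (⟨i + 1, h⟩, a)) =
              (A *ᵥ fun a' => w (Sum.inl (⟨i, by omega⟩, a'))) a +
                w (Sum.inr ⟨i, by omega⟩) * b a))) ∧
    (∀ w : ((Fin N × Fin nx) ⊕ Fin (N - 1)) → ℝ,
      Gmat N nx A b *ᵥ w = 0 →
        ∃ pcoef : Fin (N - 1) → ℝ, w = Zmat N nx A b ub *ᵥ pcoef) ∧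
    Module.finrank ℝ (LinearMap.ker (Gmat N nx A b).mulVecLin) = N - 1 := by
  have hG := Gmat_mul_Zmat A b ub (by omega : 0 < N)
  have hU := isUnit_Zmat_submatrix_inr N nx A b hub0
  have hinj : Function.Injective (Zmat N nx A b ub).mulVec := by
    intro p q hpq
    apply mulVec_injective_of_isUnit hU
    ext j
    exact congrFun hpq (Sum.inr j)
  have hspan : ∀ w : ((Fin N × Fin nx) ⊕ Fin (N - 1)) → ℝ,
      Gmat N nx A b *ᵥ w = 0 → ∃ pcoef : Fin (N - 1) → ℝ, w = Zmat N nx A b ub *ᵥ pcoef := by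
    intro w hw
    obtain ⟨p, hp⟩ := mulVec_surjective_iff_isUnit.2 hU fun j => w (Sum.inr j)
    refine ⟨p, sub_eq_zero.1 (eq_zero_of_Gmat_mulVec_eq_zero (A := A) (b := b) ?_ fun j => ?_)⟩
    · rw [mulVec_sub, hw, mulVec_mulVec, hG, zero_mulVec, sub_zero]
    · exact sub_eq_zero.2 (congrFun hp j).symm
  refine ⟨hG, mulVec_injective_iff.1 hinj, Gmat_mulVec_eq_zero_iff A b (by omega), hspan, ?_⟩
  have hker : LinearMap.ker (Gmat N nx A b).mulVecLin =
      LinearMap.range (Zmat N nx A b ub).mulVecLin := by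
    ext w
    simp only [LinearMap.mem_ker, LinearMap.mem_range, mulVecLin_apply]
    constructor
    · intro hw
      obtain ⟨p, hp⟩ := hspan w hw
      exact ⟨p, hp.symm⟩
    · rintro ⟨p, rfl⟩
      rw [mulVec_mulVec, hG, zero_mulVec]
  rw [hker, LinearMap.finrank_range_of_inj hinj, Module.finrank_fin_fun]
end

section
/- (Deadbeat response.) Let n_x ≥ 1, let A be an n_x×n_x real matrix and b ∈ ℝ^{n_x} such that the controllability matrix [b, Ab, …, A^{n_x−1}b] is invertible. Then there exist row vectors U_1, …, U_{n_x} ∈ ℝ^{1×n_x} such that the matrices defined by X_1 = I (the n_x×n_x identity) and X_{i+1} = A X_i + b U_i for 1 ≤ i ≤ n_x satisfy X_{n_x+1} = 0. Equivalently, for every initial state ξ ∈ ℝ^{n_x} the input sequence u_i = U_i ξ drives the system x_{i+1} = A x_i + b u_i from x_1 = ξ to x_{n_x+1} = 0. -/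
open Matrix

theorem state_eq_pow_mulVec_add_sum {n : ℕ} (A : Matrix (Fin n) (Fin n) ℝ) (b : Fin n → ℝ)
    (u : ℕ → ℝ) (x : ℕ → Fin n → ℝ) (N : ℕ)
    (hx : ∀ i < N, x (i + 1) = A *ᵥ x i + u i • b) :
    x N = A ^ N *ᵥ x 0 + ∑ i ∈ Finset.range N, u i • (A ^ (N - 1 - i) *ᵥ b) := by
  induction N with
  | zero => simp
  | succ N ih =>
    rw [hx N N.lt_succ_self, ih fun i hi => hx i (hi.trans N.lt_succ_self),
      Finset.sum_range_succ, mulVec_add, mulVec_mulVec, ← pow_succ', add_assoc]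
    congr 2
    · rw [mulVec_sum]
      refine Finset.sum_congr rfl fun i hi => ?_
      have hi' := Finset.mem_range.mp hi
      rw [mulVec_smul, mulVec_mulVec, ← pow_succ', show N - 1 - i + 1 = N + 1 - 1 - i by omega]
    · simp

theorem ctrbMat_mulVec {n : ℕ} (A : Matrix (Fin n) (Fin n) ℝ) (b v : Fin n → ℝ) :
    ctrbMat A b *ᵥ v = ∑ j : Fin n, v j • (A ^ (j : ℕ) *ᵥ b) := by
  ext i
  simp [ctrbMat, mulVec, dotProduct, Finset.sum_apply, mul_comm]

/-- deadbeat response: for a controllable pair `(A, b)` there exist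
feedback row vectors `U_1, …, U_{n_x}` such that the matrix recursion `X_1 = I`,
`X_{i+1} = A X_i + b U_i` ends with `X_{n_x+1} = 0`; equivalently, the inputs `u_i = U_i ξ`
drive any initial state `ξ` to the origin in `n_x` steps. (0-based indexing: `X 0 = I`
and `X nx = 0`.) -/
theorem deadbeat_response
    (nx : ℕ) (hnx : 1 ≤ nx)
    (A : Matrix (Fin nx) (Fin nx) ℝ) (b : Fin nx → ℝ) (hctrb : IsUnit (ctrbMat A b)) :
    ∃ U : ℕ → (Fin nx → ℝ),
      (∀ X : ℕ → Matrix (Fin nx) (Fin nx) ℝ,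
        X 0 = 1 → (∀ i < nx, X (i + 1) = A * X i + Matrix.vecMulVec b (U i)) →
        X nx = 0) ∧
      (∀ ξ : Fin nx → ℝ, ∀ x : ℕ → Fin nx → ℝ,
        x 0 = ξ → (∀ i < nx, x (i + 1) = A *ᵥ x i + (U i ⬝ᵥ ξ) • b) →
        x nx = 0) := by
  let W : Matrix (Fin nx) (Fin nx) ℝ := -((ctrbMat A b)⁻¹ * A ^ nx)
  have hW : ctrbMat A b * W = -A ^ nx := by
    rw [Matrix.mul_neg, mul_nonsing_inv_cancel_left _ _ ((isUnit_iff_isUnit_det _).mp hctrb)]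
  let U : ℕ → Fin nx → ℝ := fun i => W ⟨nx - 1 - i, by omega⟩
  have hU : ∀ ξ : Fin nx → ℝ, ∀ x : ℕ → Fin nx → ℝ,
      x 0 = ξ → (∀ i < nx, x (i + 1) = A *ᵥ x i + (U i ⬝ᵥ ξ) • b) → x nx = 0 := by
    intro ξ x h0 hx
    have hsum : ∑ i ∈ Finset.range nx, (U i ⬝ᵥ ξ) • (A ^ (nx - 1 - i) *ᵥ b) =
        ctrbMat A b *ᵥ (W *ᵥ ξ) := by
      rw [ctrbMat_mulVec, ← Finset.sum_range_reflect, Finset.sum_range]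
      refine Finset.sum_congr rfl fun j _ => ?_
      have hj : nx - 1 - (nx - 1 - (j : ℕ)) = j := by omega
      simp only [U, hj]
      rfl
    rw [state_eq_pow_mulVec_add_sum A b (fun i => U i ⬝ᵥ ξ) x nx hx, hsum, mulVec_mulVec, hW,
      h0, neg_mulVec, add_neg_cancel]
  refine ⟨U, fun X h0 hX => ?_, hU⟩
  refine ext_of_mulVec_single fun j => ?_
  rw [zero_mulVec]
  refine hU (Pi.single j 1) (fun i => X i *ᵥ Pi.single j 1) (by simp only [h0, one_mulVec]) fun i hi => ?_
  simp only [hX i hi, add_mulVec, ← mulVec_mulVec, vecMulVec_mulVec, op_smul_eq_smul]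
end

section
/- The symmetric (N−1)×(N−1) matrix ZᵀHZ is banded with bandwidth at most n_x: (ZᵀHZ)_{j,k} = 0 whenever |j − k| > n_x. -/
open Matrix

/-- The time (stage) to which a component of the stacked vector belongs. -/
def stage {N nx : ℕ} : (Fin N × Fin nx) ⊕ Fin (N - 1) → ℕ
  | Sum.inl (i, _) => i
  | Sum.inr i => i

theorem colU_eq_zero {ub : ℕ → ℝ} {nx j i : ℕ} (h : i < j ∨ j + nx < i) :
    colU ub nx j i = 0 :=
  if_neg (by omega)

theorem traj_colU_of_le {nx : ℕ} (A : Matrix (Fin nx) (Fin nx) ℝ) (b : Fin nx → ℝ)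
    (ub : ℕ → ℝ) (m : ℕ) {j i : ℕ} (h : i ≤ j) : traj A b (colU ub m j) i = 0 := by
  induction i with
  | zero => rfl
  | succ i ih => simp [traj, ih (by omega), colU_eq_zero (Or.inl h)]

theorem traj_colU_add {nx : ℕ} {A : Matrix (Fin nx) (Fin nx) ℝ} {b : Fin nx → ℝ}
    {ub : ℕ → ℝ} {m : ℕ} {xb : ℕ → Fin nx → ℝ} (hxb0 : xb 0 = 0)
    (hrec : ∀ i ≤ m, xb (i + 1) = A *ᵥ xb i + ub i • b) (j : ℕ) {i : ℕ} (h : i ≤ m + 1) :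
    traj A b (colU ub m j) (j + i) = xb i := by
  induction i with
  | zero => rw [hxb0]; exact traj_colU_of_le A b ub m le_rfl
  | succ i ih =>
    have hu : colU ub m j (j + i) = ub i := by
      rw [colU, if_pos (by omega), Nat.add_sub_cancel_left]
    rw [← add_assoc, traj, ih (by omega), hu, hrec i (by omega)]

theorem traj_colU_of_lt {nx : ℕ} {A : Matrix (Fin nx) (Fin nx) ℝ} {b : Fin nx → ℝ}
    {ub : ℕ → ℝ} {m : ℕ} {xb : ℕ → Fin nx → ℝ} (hxb0 : xb 0 = 0)
    (hrec : ∀ i ≤ m, xb (i + 1) = A *ᵥ xb i + ub i • b) (hend : xb (m + 1) = 0)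
    {j i : ℕ} (h : j + m < i) : traj A b (colU ub m j) i = 0 := by
  induction i, (show j + (m + 1) ≤ i by omega) using Nat.le_induction with
  | base => rw [traj_colU_add hxb0 hrec j le_rfl, hend]
  | succ i hi ih => simp [traj, ih (by omega), colU_eq_zero (Or.inr (show j + m < i by omega))]

theorem Zmat_eq_zero {N nx : ℕ} {A : Matrix (Fin nx) (Fin nx) ℝ} {b : Fin nx → ℝ}
    {ub : ℕ → ℝ} {xb : ℕ → Fin nx → ℝ} (hxb0 : xb 0 = 0)
    (hrec : ∀ i ≤ nx, xb (i + 1) = A *ᵥ xb i + ub i • b) (hend : xb (nx + 1) = 0)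
    {p : (Fin N × Fin nx) ⊕ Fin (N - 1)} {j : Fin (N - 1)}
    (h : stage p < j ∨ (j : ℕ) + nx < stage p) : Zmat N nx A b ub p j = 0 := by
  rcases p with ⟨i, a⟩ | i
  · rcases h with h | h
    · exact congrFun (traj_colU_of_le A b ub nx (le_of_lt h)) a
    · exact congrFun (traj_colU_of_lt hxb0 hrec hend h) a
  · exact colU_eq_zero h

theorem Hmat_eq_zero {N nx : ℕ} (Q : Matrix (Fin nx) (Fin nx) ℝ) (r : ℝ)
    {p q : (Fin N × Fin nx) ⊕ Fin (N - 1)} (h : stage p ≠ stage q) :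
    Hmat N nx Q r p q = 0 := by
  rcases p with ⟨i, a⟩ | i <;> rcases q with ⟨k, c⟩ | k
  · exact if_neg fun hik => h (congrArg Fin.val hik.1)
  · rfl
  · rfl
  · exact if_neg fun hik => h (congrArg Fin.val hik)

theorem Hmat_isSymm {N nx : ℕ} {Q : Matrix (Fin nx) (Fin nx) ℝ} (hQ : Q.IsSymm) (r : ℝ) :
    (Hmat N nx Q r).IsSymm := by
  refine IsSymm.ext fun p q => ?_
  rcases p with ⟨i, a⟩ | i <;> rcases q with ⟨k, c⟩ | k
  · by_cases hik : i = k
    · subst hik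
      simp [Hmat, hQ.apply a c]
    · simp [Hmat, hik, Ne.symm hik]
  · rfl
  · rfl
  · simp [Hmat, eq_comm]

/-- the symmetric reduced Hessian `ZᵀHZ` is banded with bandwidth at
most `n_x`: its `(j,k)` entry vanishes whenever `|j − k| > n_x`. -/
theorem reduced_hessian_banded
    (nx : ℕ) (hnx : 1 ≤ nx)
    (A : Matrix (Fin nx) (Fin nx) ℝ) (b : Fin nx → ℝ) (hctrb : IsUnit (ctrbMat A b))
    (Q : Matrix (Fin nx) (Fin nx) ℝ) (hQ : Q.PosDef) (r : ℝ) (hr : 0 < r)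
    (xb : ℕ → Fin nx → ℝ) (ub : ℕ → ℝ)
    (hxb0 : xb 0 = 0) (hub0 : ub 0 = 1)
    (hrec : ∀ i ≤ nx, xb (i + 1) = A *ᵥ xb i + ub i • b)
    (hend : xb (nx + 1) = 0)
    (N : ℕ) (hN : 2 ≤ N) :
    ((Zmat N nx A b ub)ᵀ * Hmat N nx Q r * Zmat N nx A b ub).IsSymm ∧
    ∀ j k : Fin (N - 1), (nx : ℤ) < |((j : ℕ) : ℤ) - ((k : ℕ) : ℤ)| →
      ((Zmat N nx A b ub)ᵀ * Hmat N nx Q r * Zmat N nx A b ub) j k = 0 := by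
  refine ⟨?_, fun j k hjk => ?_⟩
  · have hQs : Q.IsSymm := by
      simpa [IsHermitian, IsSymm, conjTranspose_eq_transpose_of_trivial] using hQ.isHermitian
    have hH := Hmat_isSymm (N := N) hQs r
    rw [IsSymm, transpose_mul, transpose_mul, transpose_transpose, hH.eq, Matrix.mul_assoc]
  · simp only [mul_apply, Finset.sum_mul, transpose_apply]
    refine Finset.sum_eq_zero fun q _ => Finset.sum_eq_zero fun p _ => ?_
    by_cases hpq : stage p = stage q
    · by_cases hp : stage p < j ∨ (j : ℕ) + nx < stage p
      · simp [Zmat_eq_zero hxb0 hrec hend hp]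
      · have hq : stage q < k ∨ (k : ℕ) + nx < stage q := by
          rw [lt_abs] at hjk
          omega
        simp [Zmat_eq_zero hxb0 hrec hend hq]
    · simp [Hmat_eq_zero Q r hpq]
end
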